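/- arXiv:1808.02606 — 6 statements merged into one kernel-verified Lean document; each statement's English description precedes it below -/
import Mathlib

section
/- Let ν ∈ ℝ and let σ ∈ (0,1), s = (1−σ)/2 with ν > −1/2 and σ < 1 + 2ν, and let B = B(ν,σ) (note B > 0). Suppose q, H, S, D : (0,∞) → ℝ are functions for which there exist constants C > 0 and t₀ ∈ (0,1) such that for all t ∈ (0,t₀): (i) exp(−q(t)) = B·t^σ·(1+r₀(t)) with |r₀(t)| ≤ C·t^{1−σ}; (ii) |H(t) + σ²/(2t)| ≤ C·t^{−σ}; (iii) |S(t) − (σ²/2)·ln t − C_S(ν,s)| ≤ C·t^{1−σ}; (iv) |D(t) − C_D(ν,s)| ≤ C·t^{1−σ}, where C_D(ν,s) := −2·ln[Γ(1−s+ν)·Γ(1+s+ν)/Γ(1/2+ν)²] + 2·ln(s+ν). Then the function τ(t) := exp[−(t/2)·H(t) + S(t)/2 − (ν/4)·D(t)]·cosh(q(t)/2) satisfies τ(t) = A·t^{(σ/4)(σ−2)}·(1+ρ(t)) with |ρ(t)| ≤ C'·max(t^σ, t^{1−σ}) for all t ∈ (0,t₁), for some constants C' > 0 and t₁ ∈ (0,1),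 where A = exp[3ζ'(−1) − (3s²+1/6)·ln 2 + F(ν−s) + F(ν+s) − 2F(−s) − 2F(s) + 2F(−1/2) − 2F(ν−1/2)]·(√π/Γ(ν+1/2))·[Γ(1−s+ν)·Γ(1+s+ν)/Γ(ν+1/2)²]^{−ν/2}·(s+ν)^{ν/2}. -/
/- STATEMENT 0: small-distance expansion τ(t) = A·t^{(σ/4)(σ−2)}·(1+O(max(t^σ,t^{1−σ})))
   of the generalized Ising tau-function, given the expansions of q, H, S, D. -/

/-- `FG z = ln G(1+z)` where `G` is the Barnes G-function, expressed via the
integral representation `∫₀^z ln Γ(1+x) dx = (z/2)ln(2π) − z(z+1)/2 + z ln Γ(1+z) − ln G(1+z)`. -/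
noncomputable def FG (z : ℝ) : ℝ :=
  z / 2 * Real.log (2 * Real.pi) - z * (z + 1) / 2 + z * Real.log (Real.Gamma (1 + z))
    - ∫ x in (0:ℝ)..z, Real.log (Real.Gamma (1 + x))

/-- `ζ'(−1)`, the derivative of the Riemann zeta function at `−1` (a real number). -/
noncomputable def zetaD1 : ℝ := (deriv riemannZeta (-1)).re

/-- The constant `C_D(ν,s)` in the expansion of `D(t) = p·∂q/∂ν + ∂S/∂ν`. -/
noncomputable def CD (ν s : ℝ) : ℝ :=
  -2 * Real.log (Real.Gamma (1 - s + ν) * Real.Gamma (1 + s + ν) / Real.Gamma (1/2 + ν) ^ 2)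
    + 2 * Real.log (s + ν)

/-- The constant `C_S(ν,s)` in the small-`t` expansion of the action integral,
with `σ = 1 − 2s`. -/
noncomputable def CS (ν s : ℝ) : ℝ :=
  -(3 * (1 - 2*s)^2 / 2) * Real.log 2 - (1 - 2*s)^2 / 2 + 6 * zetaD1 + (1/6) * Real.log 2
    + 2 * (FG (ν - s) + FG (ν + s) - 2 * FG (-s) - 2 * FG s)
    + 4 * (FG (-(1/2)) - FG (ν - 1/2))
    + Real.log Real.pi - 2 * Real.log (Real.Gamma (1/2 + ν))
    + Real.log (Real.Gamma s ^ 2 * Real.Gamma (1 - s + ν)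
        / (Real.Gamma (1 - s) ^ 2 * Real.Gamma (1 + s + ν)))
    - 2 * ν * Real.log (Real.Gamma (1 - s + ν) * Real.Gamma (1 + s + ν)
        / Real.Gamma (1/2 + ν) ^ 2)
    + (1 + 2*ν) * Real.log (s + ν)

/-- The connection coefficient `A = A(ν,s)` of Theorem 1.1. -/
noncomputable def Acoef (ν s : ℝ) : ℝ :=
  Real.exp (3 * zetaD1 - (3 * s^2 + 1/6) * Real.log 2
      + FG (ν - s) + FG (ν + s) - 2 * FG (-s) - 2 * FG s + 2 * FG (-(1/2)) - 2 * FG (ν - 1/2))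
    * (Real.sqrt Real.pi / Real.Gamma (ν + 1/2))
    * (Real.Gamma (1 - s + ν) * Real.Gamma (1 + s + ν) / Real.Gamma (ν + 1/2) ^ 2) ^ (-(ν/2))
    * (s + ν) ^ (ν/2)

theorem aux_log (r : ℝ) (h : |r| ≤ 1/2) : |Real.log (1 + r)| ≤ 2 * |r| := by
  have h1 := abs_le.mp h
  have hp : 0 < 1 + r := by linarith [h1.1]
  have hu := Real.log_le_sub_one_of_pos hp
  have hl := Real.one_sub_inv_le_log_of_pos hp
  have e : 1 - (1 + r)⁻¹ = r / (1 + r) := by field_simp; ring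
  rw [e] at hl
  have : -(2 * |r|) ≤ r / (1 + r) := by
    rw [le_div_iff₀ hp]
    have := neg_abs_le r
    have := abs_nonneg r
    nlinarith [h1.1]
  rw [abs_le]
  exact ⟨by linarith, by linarith [le_abs_self r, abs_nonneg r]⟩

theorem aux_exp (x K m : ℝ) (h : |x| ≤ K * m) (hK : 0 ≤ K) (hm0 : 0 ≤ m) (hm : m ≤ 1) :
    |Real.exp x - 1| ≤ (K * Real.exp K) * m := by
  have hxK : |x| ≤ K := by nlinarith
  have h1 : |Real.exp x - 1| ≤ |x| * Real.exp |x| := by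
    rw [abs_le]
    have a1 := Real.add_one_le_exp x
    have a2 := Real.add_one_le_exp (-x)
    have a3 : 1 ≤ Real.exp |x| := Real.one_le_exp (abs_nonneg x)
    have a4 : Real.exp x ≤ Real.exp |x| := Real.exp_le_exp.mpr (le_abs_self x)
    have a5 : Real.exp x * Real.exp (-x) = 1 := by rw [← Real.exp_add]; simp
    have a6 := Real.exp_pos x
    constructor
    · nlinarith [neg_abs_le x, abs_nonneg x]
    · have : Real.exp x - 1 ≤ x * Real.exp x := by nlinarith
      have : x * Real.exp x ≤ |x| * Real.exp x := by
        gcongr; exact le_abs_self x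
      have : |x| * Real.exp x ≤ |x| * Real.exp |x| := by gcongr
      linarith
  calc _ ≤ _ := h1
    _ ≤ (K * m) * Real.exp K := by gcongr
    _ = _ := by ring

/-- The constant matching. -/
theorem aux_const (ν σ s B : ℝ) (hσ : σ ∈ Set.Ioo (0:ℝ) 1) (hν : -(1/2 : ℝ) < ν)
    (hσν : σ < 1 + 2 * ν) (hs : s = (1 - σ) / 2)
    (hB : B = (2:ℝ) ^ (-(3 * σ)) * (Real.Gamma ((1 - σ)/2) / Real.Gamma ((1 + σ)/2)) ^ 2
        * (Real.Gamma (ν + (1 + σ)/2) / Real.Gamma (ν + (1 - σ)/2))) :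
    Acoef ν s = Real.exp (σ^2/4 + CS ν s / 2 - ν/4 * CD ν s - Real.log 2 - Real.log B / 2) := by
  obtain ⟨h0, h1⟩ := hσ
  have e1 : (1 + σ)/2 = 1 - s := by rw [hs]; ring
  have e2 : ν + (1 - s) = 1 - s + ν := by ring
  have e3 : ν + s = s + ν := by ring
  have e4 : σ = 1 - 2 * s := by rw [hs]; ring
  rw [e1, ← hs, e2, e3] at hB
  have g0 : 0 < s + ν := by rw [hs]; linarith
  have g1 : 0 < Real.Gamma s := Real.Gamma_pos_of_pos (by linarith)
  have g2 : 0 < Real.Gamma (1 - s) := Real.Gamma_pos_of_pos (by linarith)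
  have g3 : 0 < Real.Gamma (1 - s + ν) := Real.Gamma_pos_of_pos (by linarith)
  have g4 : 0 < Real.Gamma (s + ν) := Real.Gamma_pos_of_pos g0
  have g5 : 0 < Real.Gamma (1/2 + ν) := Real.Gamma_pos_of_pos (by linarith)
  have e5 : Real.Gamma (1 + s + ν) = (s + ν) * Real.Gamma (s + ν) := by
    rw [← Real.Gamma_add_one g0.ne']; congr 1; ring
  have lB : Real.log B = -(3 * σ) * Real.log 2
      + 2 * (Real.log (Real.Gamma s) - Real.log (Real.Gamma (1 - s)))
      + (Real.log (Real.Gamma (1 - s + ν)) - Real.log (Real.Gamma (s + ν))) := by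
    rw [hB, Real.log_mul (by positivity) (by positivity),
      Real.log_mul (by positivity) (by positivity), Real.log_rpow (by norm_num),
      Real.log_pow, Real.log_div g1.ne' g2.ne', Real.log_div g3.ne' g4.ne']
    push_cast; ring
  have lR : Real.log (Real.Gamma s ^ 2 * Real.Gamma (1 - s + ν)
        / (Real.Gamma (1 - s) ^ 2 * ((s + ν) * Real.Gamma (s + ν))))
      = 2 * Real.log (Real.Gamma s) + Real.log (Real.Gamma (1 - s + ν))
        - (2 * Real.log (Real.Gamma (1 - s)) + (Real.log (s + ν)
          + Real.log (Real.Gamma (s + ν)))) := by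
    rw [Real.log_div (by positivity) (by positivity), Real.log_mul (by positivity) (by positivity),
      Real.log_mul (by positivity) (by positivity), Real.log_mul (by positivity) (by positivity),
      Real.log_pow, Real.log_pow]
    push_cast; ring
  have hX : 0 < Real.Gamma (1 - s + ν) * ((s + ν) * Real.Gamma (s + ν))
      / Real.Gamma (1/2 + ν) ^ 2 := by positivity
  have hsq : Real.sqrt Real.pi / Real.Gamma (1/2 + ν)
      = Real.exp (Real.log Real.pi / 2 - Real.log (Real.Gamma (1/2 + ν))) := by
    rw [Real.exp_sub, Real.exp_log g5, ← Real.log_sqrt Real.pi_pos.le,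
      Real.exp_log (Real.sqrt_pos.mpr Real.pi_pos)]
  unfold Acoef CS CD
  rw [add_comm ν (1/2), e5, lB, lR, hsq, Real.rpow_def_of_pos hX, Real.rpow_def_of_pos g0,
    ← Real.exp_add, ← Real.exp_add, ← Real.exp_add, e4]
  congr 1
  ring

theorem stmt0 (ν σ s B : ℝ) (hσ : σ ∈ Set.Ioo (0:ℝ) 1) (hν : -(1/2 : ℝ) < ν)
    (hσν : σ < 1 + 2 * ν) (hs : s = (1 - σ) / 2)
    (hB : B = (2:ℝ) ^ (-(3 * σ)) * (Real.Gamma ((1 - σ)/2) / Real.Gamma ((1 + σ)/2)) ^ 2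
        * (Real.Gamma (ν + (1 + σ)/2) / Real.Gamma (ν + (1 - σ)/2)))
    (hBpos : 0 < B)
    (q H S D : ℝ → ℝ) (C t₀ : ℝ) (hC : 0 < C) (ht₀ : t₀ ∈ Set.Ioo (0:ℝ) 1)
    (hq : ∀ t ∈ Set.Ioo (0:ℝ) t₀, ∃ r₀ : ℝ,
      Real.exp (-(q t)) = B * t ^ σ * (1 + r₀) ∧ |r₀| ≤ C * t ^ (1 - σ))
    (hH : ∀ t ∈ Set.Ioo (0:ℝ) t₀, |H t + σ^2 / (2 * t)| ≤ C * t ^ (-σ))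
    (hS : ∀ t ∈ Set.Ioo (0:ℝ) t₀, |S t - σ^2 / 2 * Real.log t - CS ν s| ≤ C * t ^ (1 - σ))
    (hD : ∀ t ∈ Set.Ioo (0:ℝ) t₀, |D t - CD ν s| ≤ C * t ^ (1 - σ)) :
    ∃ C' t₁ : ℝ, 0 < C' ∧ t₁ ∈ Set.Ioo (0:ℝ) 1 ∧ ∀ t ∈ Set.Ioo (0:ℝ) t₁, ∃ ρ : ℝ,
      Real.exp (-(t/2) * H t + S t / 2 - ν/4 * D t) * Real.cosh (q t / 2)
        = Acoef ν s * t ^ (σ/4 * (σ - 2)) * (1 + ρ)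
      ∧ |ρ| ≤ C' * max (t ^ σ) (t ^ (1 - σ)) := by
  have hA := aux_const ν σ s B hσ hν hσν hs hB
  obtain ⟨h0, h1⟩ := hσ
  obtain ⟨ht0, ht1⟩ := ht₀
  have hs1 : 0 < 1 - σ := by linarith
  set K : ℝ := 2 * C + |ν| * C + 2 * B with hK
  have hKpos : 0 < K := by positivity
  have hx : 0 < (1 / (2 * C)) ^ (1 / (1 - σ)) := by positivity
  refine ⟨K * Real.exp K, min t₀ ((1 / (2 * C)) ^ (1 / (1 - σ))), by positivity,
    ⟨lt_min ht0 hx, lt_of_le_of_lt (min_le_left _ _) ht1⟩, ?_⟩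
  rintro t ⟨htp, ht⟩
  have htt : t < t₀ := lt_of_lt_of_le ht (min_le_left _ _)
  have ht1' : t < 1 := htt.trans ht1
  have htI : t ∈ Set.Ioo (0:ℝ) t₀ := ⟨htp, htt⟩
  have hsm : C * t ^ (1 - σ) ≤ 1 / 2 := by
    have h2 : t ^ (1 - σ) ≤ ((1 / (2 * C)) ^ (1 / (1 - σ))) ^ (1 - σ) :=
      Real.rpow_le_rpow htp.le (ht.le.trans (min_le_right _ _)) hs1.le
    rw [← Real.rpow_mul (by positivity), one_div_mul_cancel hs1.ne', Real.rpow_one] at h2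
    calc C * t ^ (1 - σ) ≤ C * (1 / (2 * C)) := by gcongr
      _ = 1 / 2 := by field_simp
  obtain ⟨r, hr, hrb⟩ := hq t htI
  have hH' := hH t htI
  have hS' := hS t htI
  have hD' := hD t htI
  set m := max (t ^ σ) (t ^ (1 - σ)) with hm
  have m1 : t ^ σ ≤ m := le_max_left _ _
  have m2 : t ^ (1 - σ) ≤ m := le_max_right _ _
  have hts : 0 < t ^ σ := by positivity
  have m0 : 0 ≤ m := hts.le.trans m1
  have mle : m ≤ 1 := max_le (Real.rpow_le_one htp.le ht1'.le h0.le)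
    (Real.rpow_le_one htp.le ht1'.le hs1.le)
  have hr2 : |r| ≤ 1 / 2 := hrb.trans hsm
  have hr3 := abs_le.mp hr2
  have hrp : 0 < 1 + r := by linarith [hr3.1]
  have hlog := aux_log r hr2
  have hqv : q t = -(Real.log B + σ * Real.log t + Real.log (1 + r)) := by
    have := congrArg Real.log hr
    rw [Real.log_exp, Real.log_mul (by positivity) hrp.ne', Real.log_mul hBpos.ne' hts.ne',
      Real.log_rpow htp] at this
    linarith
  set L := Real.log (1 + Real.exp (-(q t))) with hL
  have hLp : 0 < 1 + Real.exp (-(q t)) := by positivity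
  have hL0 : 0 ≤ L := Real.log_nonneg (by linarith [Real.exp_pos (-(q t))])
  have hL1 : L ≤ 2 * B * m := by
    have a := Real.log_le_sub_one_of_pos hLp
    have b : Real.exp (-(q t)) ≤ B * m * 2 := by
      rw [hr]; gcongr; linarith [hr3.2]
    linarith
  have hcosh : Real.cosh (q t / 2) = Real.exp (q t / 2 + L - Real.log 2) := by
    rw [Real.exp_sub, Real.exp_add, hL, Real.exp_log hLp, Real.exp_log (by norm_num),
      Real.cosh_eq, mul_add, mul_one, ← Real.exp_add]
    congr 3; ring
  set ε := (-(t/2) * (H t + σ^2 / (2 * t))) + (S t - σ^2 / 2 * Real.log t - CS ν s) / 2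
    - ν / 4 * (D t - CD ν s) - Real.log (1 + r) / 2 + L with hε
  refine ⟨Real.exp ε - 1, ?_, aux_exp ε K m ?_ hKpos.le m0 mle⟩
  · rw [hA, hcosh, Real.rpow_def_of_pos htp, ← Real.exp_add, ← Real.exp_add,
      add_sub_cancel, ← Real.exp_add]
    congr 1
    rw [hε, hqv]
    field_simp
    ring
  · have b1 : |-(t/2) * (H t + σ^2 / (2 * t))| ≤ C / 2 * m := by
      rw [abs_mul, abs_neg, abs_of_pos (by positivity : 0 < t / 2)]
      calc t / 2 * |H t + σ^2 / (2 * t)| ≤ t / 2 * (C * t ^ (-σ)) := by gcongr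
        _ = C / 2 * t ^ (1 - σ) := by
          rw [sub_eq_add_neg, Real.rpow_add htp, Real.rpow_one]; ring
        _ ≤ _ := by gcongr
    have hCm : C * t ^ (1 - σ) ≤ C * m := by gcongr
    have b3 : |ν / 4 * (D t - CD ν s)| ≤ |ν| / 4 * (C * m) := by
      rw [abs_mul, abs_div, abs_of_pos (by norm_num : (0:ℝ) < 4)]
      gcongr
      exact hD'.trans hCm
    have b2 := abs_le.mp (hS'.trans hCm)
    have b4 := abs_le.mp (hlog.trans (mul_le_mul_of_nonneg_left (hrb.trans hCm) zero_le_two))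
    have b1 := abs_le.mp b1
    have b3 := abs_le.mp b3
    have p1 : 0 ≤ |ν| * (C * m) := by positivity
    have p2 : 0 ≤ C * m := by positivity
    have p3 : 0 ≤ B * m := by positivity
    have e : K * m = 2 * (C * m) + |ν| * (C * m) + 2 * (B * m) := by rw [hK]; ring
    rw [e, abs_le, hε]
    constructor <;> linarith [b1.1, b1.2, b2.1, b2.2, b3.1, b3.2, b4.1, b4.2]
end

section
/- Let ν, λ ∈ ℝ and let q, p : (0,∞) → ℝ be differentiable functions solving the Hamiltonian system q'(t) = −p(t)/t and p'(t) = −(t/2)·sinh(2q(t)) − 2ν·sinh(q(t)) for all t > 0. Set H(t) := (t/2)·sinh²(q(t)) − p(t)²/(2t) + 4ν·sinh²(q(t)/2). Assume that the functions s ↦ H(s), s ↦ sinh²(q(s)/2) and s ↦ p(s)·q'(s) − H(s) are integrable on (a,∞) for every a > 0, and that t·H(t) → 0 as t → +∞. Then for every t > 0: ∫ₜ^∞ H(s) ds = −t·H(t) + ∫ₜ^∞ (p(s)·q'(s) − H(s)) ds + 4ν·∫ₜ^∞ sinh²(q(s)/2) ds. -/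
/- STATEMENT 1 (Proposition 2.1): rewriting the Hamiltonian integral as
−t·H(t) plus the action integral plus 4ν·∫ sinh²(q/2). -/

theorem stmt1 (ν lam : ℝ) (q p H : ℝ → ℝ)
    (hq : ∀ t > (0:ℝ), HasDerivAt q (-(p t) / t) t)
    (hp : ∀ t > (0:ℝ), HasDerivAt p (-(t/2) * Real.sinh (2 * q t) - 2 * ν * Real.sinh (q t)) t)
    (hH : ∀ t : ℝ, H t = t/2 * Real.sinh (q t) ^ 2 - (p t)^2 / (2 * t)
        + 4 * ν * Real.sinh (q t / 2) ^ 2)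
    (hint1 : ∀ a > (0:ℝ), MeasureTheory.IntegrableOn H (Set.Ioi a))
    (hint2 : ∀ a > (0:ℝ), MeasureTheory.IntegrableOn
      (fun s => Real.sinh (q s / 2) ^ 2) (Set.Ioi a))
    (hint3 : ∀ a > (0:ℝ), MeasureTheory.IntegrableOn
      (fun s => p s * deriv q s - H s) (Set.Ioi a))
    (hlim : Filter.Tendsto (fun t => t * H t) Filter.atTop (nhds 0)) :
    ∀ t > (0:ℝ),
      (∫ s in Set.Ioi t, H s)
        = -(t * H t) + (∫ s in Set.Ioi t, (p s * deriv q s - H s))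
          + 4 * ν * ∫ s in Set.Ioi t, Real.sinh (q s / 2) ^ 2 := by
  intro t ht
  have key : ∀ x ∈ Set.Ici t, HasDerivAt (fun t => t * H t)
      (H x - (p x * deriv q x - H x) - 4 * ν * Real.sinh (q x / 2) ^ 2) x := by
    intro x hx
    have hx0 : 0 < x := lt_of_lt_of_le ht hx
    have hne : x ≠ 0 := hx0.ne'
    have hqx := hq x hx0
    have hpx := hp x hx0
    have h1 := (((hasDerivAt_id x).pow 2).div_const 2).mul (hqx.sinh.pow 2)
    have h2 := (hpx.pow 2).div_const 2
    have h3 := ((hasDerivAt_id x).const_mul (4 * ν)).mul ((hqx.div_const 2).sinh.pow 2)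
    have h4 := (h1.sub h2).add h3
    refine HasDerivAt.congr_of_eventuallyEq (h4.congr_deriv ?_) ?_
    rotate_left
    · filter_upwards [lt_mem_nhds hx0] with y hy
      have hy' : y ≠ 0 := ne_of_gt hy
      show y * H y = y ^ 2 / 2 * Real.sinh (q y) ^ 2 - p y ^ 2 / 2
        + 4 * ν * y * Real.sinh (q y / 2) ^ 2
      rw [hH]
      field_simp
    have e1 : Real.sinh (q x) = 2 * Real.sinh (q x / 2) * Real.cosh (q x / 2) := by
      rw [← Real.sinh_two_mul]; congr 1; ring
    rw [hqx.deriv, hH, Real.sinh_two_mul]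
    simp only [id, Pi.pow_apply]
    have e2 := e1
    generalize Real.sinh (q x) = S at *
    generalize Real.cosh (q x) = C at *
    generalize Real.sinh (q x / 2) = a at *
    generalize Real.cosh (q x / 2) = b at *
    subst e1
    field_simp
    ring
  have hi := ((hint1 t ht).sub (hint3 t ht)).sub ((hint2 t ht).const_mul (4 * ν))
  have h := MeasureTheory.integral_Ioi_of_hasDerivAt_of_tendsto' key hi hlim
  have hs : MeasureTheory.IntegrableOn (fun x => H x - (p x * deriv q x - H x)) (Set.Ioi t) :=
    (hint1 t ht).sub (hint3 t ht)
  rw [MeasureTheory.integral_sub hs ((hint2 t ht).const_mul (4 * ν)),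
    MeasureTheory.integral_sub (hint1 t ht) (hint3 t ht), MeasureTheory.integral_const_mul] at h
  linarith
end

section
/- Let ν ∈ ℝ, λ₀ > 0, and let q, p : (0,∞) × [0,λ₀] → ℝ be such that: (i) for each λ ∈ [0,λ₀], the functions t ↦ q(t,λ), t ↦ p(t,λ) are differentiable and solve the Hamiltonian system ∂q/∂t = −p/t, ∂p/∂t = −(t/2)·sinh(2q) − 2ν·sinh(q); (ii) q and p are differentiable in λ, with the mixed partial derivatives of q equal: ∂²q/∂λ∂t = ∂²q/∂t∂λ; (iii) q(t,0) = 0 and p(t,0) = 0 for all t > 0; (iv) for each t > 0 and λ the integral S(t,λ) := ∫ₜ^∞ (p(s,λ)·∂q/∂s(s,λ) − H(s,λ)) ds converges absolutely, λ ↦ S(t,λ) is differentiable, and differentiation under the integral sign is valid: ∂S/∂λ(t,λ) = ∫ₜ^∞ ∂/∂λ[p·∂q/∂s − H](s,λ) ds; (v) p(s,λ)·∂q/∂λ(s,λ) → 0 as s → +∞ for each λ; (vi) λ' ↦ p(t,λ')·∂q/∂λ(t,λ') is continuous on [0,λ₀]. Then for all t > 0 and λ ∈ [0,λ₀]: S(t,λ)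 = −∫₀^λ p(t,λ')·(∂q/∂λ)(t,λ') dλ'. -/
/- STATEMENT 2 (Corollary 2.2): trading the t-integral defining the action
S(t,λ) for a λ-integral, S(t,λ) = −∫₀^λ p·∂q/∂λ' dλ'. -/

/-- The Hamiltonian `H(q,p,t,ν)` evaluated along a family of solutions `(q,p)`
depending on a second parameter. -/
noncomputable def Ham (ν : ℝ) (q p : ℝ → ℝ → ℝ) (t l : ℝ) : ℝ :=
  t/2 * Real.sinh (q t l) ^ 2 - (p t l) ^ 2 / (2 * t) + 4 * ν * Real.sinh (q t l / 2) ^ 2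

/-- The potential part of the Hamiltonian. -/
noncomputable def auxV (ν s x : ℝ) : ℝ :=
  s/2 * Real.sinh x ^ 2 + 4 * ν * Real.sinh (x / 2) ^ 2

/-- The derivative of the potential. -/
noncomputable def auxW (ν s x : ℝ) : ℝ :=
  (s/2) * Real.sinh (2 * x) + 2 * ν * Real.sinh x

lemma auxV_deriv (ν s x : ℝ) : HasDerivAt (auxV ν s) (auxW ν s x) x := by
  unfold auxV auxW
  have h1 := ((Real.hasDerivAt_sinh x).pow 2).const_mul (s/2)
  have h2 := ((((hasDerivAt_id x).div_const 2).sinh).pow 2).const_mul (4 * ν)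
  refine (h1.add h2).congr_deriv ?_
  have e1 : Real.sinh (2 * x) = 2 * Real.sinh x * Real.cosh x := Real.sinh_two_mul x
  have e2 : Real.sinh x = 2 * Real.sinh (x/2) * Real.cosh (x/2) := by
    rw [← Real.sinh_two_mul]; congr 1; ring
  rw [e1]
  simp only [id]
  push_cast
  rw [show 2 * ν * Real.sinh x = 2 * ν * (2 * Real.sinh (x/2) * Real.cosh (x/2)) by rw [← e2]]
  ring

lemma auxW_deriv (ν s x : ℝ) :
    HasDerivAt (auxW ν s) (s * Real.cosh (2 * x) + 2 * ν * Real.cosh x) x := by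
  unfold auxW
  have h1 := (((hasDerivAt_id x).const_mul 2).sinh).const_mul (s/2)
  have h2 := (Real.hasDerivAt_sinh x).const_mul (2 * ν)
  refine (h1.add h2).congr_deriv ?_
  simp only [id]
  ring

lemma aux_lip (ν R T : ℝ) (hT : 0 ≤ T) : ∃ K : ℝ, 0 ≤ K ∧ ∀ s ∈ Set.Icc 0 T, ∀ x y : ℝ,
    |x| ≤ R → |y| ≤ R → |auxW ν s y - auxW ν s x| ≤ K * |y - x| ∧
      |auxV ν s y - auxV ν s x - auxW ν s x * (y - x)| ≤ K * (y - x) ^ 2 := by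
  have hK0 : 0 ≤ T * Real.cosh (2 * R) + 2 * |ν| * Real.cosh R := by
    have := Real.cosh_pos (2 * R)
    have := Real.cosh_pos R
    positivity
  refine ⟨T * Real.cosh (2 * R) + 2 * |ν| * Real.cosh R, hK0, ?_⟩
  intro s hs
  have key : ∀ x y : ℝ, |x| ≤ R → |y| ≤ R → |auxW ν s y - auxW ν s x| ≤
      (T * Real.cosh (2 * R) + 2 * |ν| * Real.cosh R) * |y - x| := by
    intro x y hx hy
    have := Convex.norm_image_sub_le_of_norm_hasDerivWithin_le (f := auxW ν s)
      (f' := fun x => s * Real.cosh (2 * x) + 2 * ν * Real.cosh x) (s := Set.Icc (-R) R)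
      (C := T * Real.cosh (2 * R) + 2 * |ν| * Real.cosh R) (x := x) (y := y)
      (fun z _ => (auxW_deriv ν s z).hasDerivWithinAt) ?_ (convex_Icc _ _)
      (abs_le.1 hx) (abs_le.1 hy)
    · simpa using this
    · intro z hz
      have hz' : |z| ≤ R := abs_le.2 hz
      have hR : 0 ≤ R := (abs_nonneg z).trans hz'
      have c1 : Real.cosh (2 * z) ≤ Real.cosh (2 * R) := by
        rw [Real.cosh_le_cosh, abs_mul, abs_mul, abs_of_nonneg hR]
        gcongr
      have c2 : Real.cosh z ≤ Real.cosh R := by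
        rw [Real.cosh_le_cosh, abs_of_nonneg hR]; exact hz'
      have p1 := Real.cosh_pos (2 * z)
      have p2 := Real.cosh_pos z
      rw [Real.norm_eq_abs]
      refine (abs_add_le _ _).trans ?_
      rw [abs_mul, abs_mul, abs_mul, abs_of_nonneg hs.1, abs_of_pos p1, abs_of_pos p2, abs_two]
      have := hs.2
      gcongr
  intro x y hx hy
  refine ⟨key x y hx hy, ?_⟩
  have := Convex.norm_image_sub_le_of_norm_hasDerivWithin_le
      (f := fun z => auxV ν s z - auxW ν s x * z)
      (f' := fun z => auxW ν s z - auxW ν s x * 1) (s := Set.uIcc x y)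
      (C := (T * Real.cosh (2 * R) + 2 * |ν| * Real.cosh R) * |y - x|) (x := x) (y := y)
      (fun z _ => ((auxV_deriv ν s z).sub ((hasDerivAt_id z).const_mul _)).hasDerivWithinAt) ?_
      (convex_uIcc _ _) Set.left_mem_uIcc Set.right_mem_uIcc
  · rw [Real.norm_eq_abs, Real.norm_eq_abs, mul_assoc, abs_mul_abs_self] at this
    convert this using 1
    · congr 1; ring
    · ring
  · intro z hz
    have hzR : |z| ≤ R := by
      have h1 := abs_le.1 hx
      have h2 := abs_le.1 hy
      have : Set.uIcc x y ⊆ Set.Icc (-R) R := Set.uIcc_subset_Icc h1 h2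
      exact abs_le.2 (this hz)
    rw [mul_one, Real.norm_eq_abs]
    refine (key x z hx hzR).trans ?_
    exact mul_le_mul_of_nonneg_left (Set.abs_sub_left_of_mem_uIcc hz) hK0

lemma aux_cont (ν : ℝ) (q p : ℝ → ℝ) {t₁ t₂ : ℝ} (h₁ : 0 < t₁)
    (hq : ContinuousOn q (Set.Icc t₁ t₂)) (hp : ContinuousOn p (Set.Icc t₁ t₂)) :
    ContinuousOn (fun s => -(p s)^2/(2*s) - auxV ν s (q s)) (Set.Icc t₁ t₂) := by
  unfold auxV
  have hs : ∀ s ∈ Set.Icc t₁ t₂, 2 * s ≠ 0 := fun s hs => by have := h₁.trans_le hs.1; positivity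
  have c1 : ContinuousOn (fun s => Real.sinh (q s)) (Set.Icc t₁ t₂) :=
    Real.continuous_sinh.comp_continuousOn hq
  have c2 : ContinuousOn (fun s => Real.sinh (q s / 2)) (Set.Icc t₁ t₂) :=
    Real.continuous_sinh.comp_continuousOn (hq.div_const 2)
  fun_prop (disch := assumption)

/-- First variation of the action between two times, with quadratic error. -/
lemma aux_variation (ν : ℝ) (q p : ℝ → ℝ) {t₁ t₂ : ℝ} (h₁ : 0 < t₁) (h₁₂ : t₁ ≤ t₂)
    (hq : ∀ t > (0:ℝ), HasDerivAt q (-(p t)/t) t)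
    (hp : ∀ t > (0:ℝ), HasDerivAt p (-auxW ν t (q t)) t) :
    ∃ C η : ℝ, 0 < η ∧ ∀ Q P : ℝ → ℝ, (∀ t > (0:ℝ), HasDerivAt Q (-(P t)/t) t) →
      (∀ t > (0:ℝ), HasDerivAt P (-auxW ν t (Q t)) t) → ∀ ε > 0, ε ≤ η →
      (Q t₁ - q t₁)^2 + (P t₁ - p t₁)^2 ≤ ε →
      |((∫ s in t₁..t₂, (-(P s)^2/(2*s) - auxV ν s (Q s)))
        - (∫ s in t₁..t₂, (-(p s)^2/(2*s) - auxV ν s (q s))))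
        - (p t₂ * (Q t₂ - q t₂) - p t₁ * (Q t₁ - q t₁))| ≤ C * ε := by
  have pos : ∀ s ∈ Set.Icc t₁ t₂, 0 < s := fun s hs => h₁.trans_le hs.1
  have hqc : ContinuousOn q (Set.Icc t₁ t₂) := fun s hs =>
    (hq s (pos s hs)).continuousAt.continuousWithinAt
  have hpc : ContinuousOn p (Set.Icc t₁ t₂) := fun s hs =>
    (hp s (pos s hs)).continuousAt.continuousWithinAt
  obtain ⟨R, hR⟩ := isCompact_Icc.exists_bound_of_continuousOn hqc
  obtain ⟨K, hK0, hK⟩ := aux_lip ν (R + 1) t₂ (h₁.le.trans h₁₂)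
  set M : ℝ := 1 / t₁ + K + 1 with hM
  have hM0 : 0 < M := by positivity
  refine ⟨(1/(2*t₁) + K) * Real.exp (M * (t₂ - t₁)) * (t₂ - t₁), Real.exp (-(M * (t₂ - t₁))),
    Real.exp_pos _, ?_⟩
  intro Q P hQ hP ε hε hεη hini
  have hQc : ContinuousOn Q (Set.Icc t₁ t₂) := fun s hs =>
    (hQ s (pos s hs)).continuousAt.continuousWithinAt
  have hPc : ContinuousOn P (Set.Icc t₁ t₂) := fun s hs =>
    (hP s (pos s hs)).continuousAt.continuousWithinAt
  have hB1 : ∀ s ∈ Set.Icc t₁ t₂, ε * Real.exp (M * (s - t₁)) ≤ 1 := by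
    intro s hs
    calc ε * Real.exp (M * (s - t₁)) ≤ Real.exp (-(M * (t₂ - t₁))) * Real.exp (M * (t₂ - t₁)) := by
          have := hs.2
          gcongr
      _ = 1 := by rw [← Real.exp_add]; simp
  have hclose : ∀ s ∈ Set.Icc t₁ t₂, (Q s - q s)^2 + (P s - p s)^2 ≤ 1 →
      |q s| ≤ R + 1 ∧ |Q s| ≤ R + 1 := by
    intro s hs h
    have h1 := hR s hs
    rw [Real.norm_eq_abs] at h1
    have h2 : |Q s - q s| ≤ 1 := by
      rw [← sq_le_one_iff_abs_le_one]
      nlinarith [sq_nonneg (P s - p s)]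
    refine ⟨by linarith, ?_⟩
    calc |Q s| = |q s + (Q s - q s)| := by congr 1; ring
      _ ≤ |q s| + |Q s - q s| := abs_add_le _ _
      _ ≤ R + 1 := by linarith
  have hN : ∀ s ∈ Set.Icc t₁ t₂, (Q s - q s)^2 + (P s - p s)^2 ≤ ε * Real.exp (M * (s - t₁)) := by
    have hder : ∀ s > (0:ℝ), HasDerivAt (fun s => (Q s - q s)^2 + (P s - p s)^2)
        (2 * (Q s - q s) * (-(P s)/s - -(p s)/s)
          + 2 * (P s - p s) * (-auxW ν s (Q s) - -auxW ν s (q s))) s := by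
      intro s hs
      refine ((((hQ s hs).sub (hq s hs)).pow 2).add (((hP s hs).sub (hp s hs)).pow 2)).congr_deriv ?_
      simp
    refine image_le_of_deriv_right_lt_deriv_boundary
      (f := fun s => (Q s - q s)^2 + (P s - p s)^2)
      (B := fun s => ε * Real.exp (M * (s - t₁)))
      (B' := fun s => ε * (Real.exp (M * (s - t₁)) * (M * 1)))
      (fun s hs => (hder s (pos s hs)).continuousAt.continuousWithinAt)
      (fun s hs => (hder s (pos s (Set.Ico_subset_Icc_self hs))).hasDerivWithinAt)
      (by simpa using hini)
      (fun s => ((((hasDerivAt_id s).sub_const t₁).const_mul M).exp).const_mul ε) ?_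
    intro s hs heq
    have hs' := Set.Ico_subset_Icc_self hs
    have hs0 := pos s hs'
    have hBpos : 0 < ε * Real.exp (M * (s - t₁)) := by positivity
    obtain ⟨b1, b2⟩ := hclose s hs' (heq ▸ hB1 s hs')
    have hl := (hK s ⟨hs0.le, hs'.2⟩ (q s) (Q s) b1 b2).1
    have e1 : 2 * (Q s - q s) * (-(P s)/s - -(p s)/s)
        ≤ (1/t₁) * ((Q s - q s)^2 + (P s - p s)^2) := by
      have i1 : 1/s ≤ 1/t₁ := one_div_le_one_div_of_le h₁ hs'.1
      calc 2 * (Q s - q s) * (-(P s)/s - -(p s)/s)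
          = (1/s) * (-(2 * (Q s - q s) * (P s - p s))) := by ring
        _ ≤ (1/s) * ((Q s - q s)^2 + (P s - p s)^2) := by
            gcongr
            nlinarith [sq_nonneg ((Q s - q s) + (P s - p s))]
        _ ≤ _ := by gcongr
    have e2 : 2 * (P s - p s) * (-auxW ν s (Q s) - -auxW ν s (q s))
        ≤ K * ((Q s - q s)^2 + (P s - p s)^2) := by
      calc 2 * (P s - p s) * (-auxW ν s (Q s) - -auxW ν s (q s))
          ≤ |2 * (P s - p s) * (-auxW ν s (Q s) - -auxW ν s (q s))| := le_abs_self _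
        _ = 2 * |P s - p s| * |auxW ν s (Q s) - auxW ν s (q s)| := by
            rw [abs_mul, abs_mul, abs_two, ← abs_neg (-auxW ν s (Q s) - -auxW ν s (q s))]
            congr 2; ring
        _ ≤ 2 * |P s - p s| * (K * |Q s - q s|) := by gcongr
        _ = K * (2 * |P s - p s| * |Q s - q s|) := by ring
        _ ≤ K * ((Q s - q s)^2 + (P s - p s)^2) := by
            gcongr
            rw [← sq_abs (Q s - q s), ← sq_abs (P s - p s)]
            nlinarith [sq_nonneg (|Q s - q s| - |P s - p s|)]
    rw [heq] at e1 e2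
    have : ε * (Real.exp (M * (s - t₁)) * (M * 1)) = (1/t₁) * (ε * Real.exp (M * (s - t₁)))
        + K * (ε * Real.exp (M * (s - t₁))) + ε * Real.exp (M * (s - t₁)) := by
      rw [hM]; ring
    rw [this]
    linarith
  have hcW : ∀ f : ℝ → ℝ, ContinuousOn f (Set.Icc t₁ t₂) →
      ContinuousOn (fun s => auxW ν s (f s)) (Set.Icc t₁ t₂) := by
    intro f hf
    unfold auxW
    have c1 : ContinuousOn (fun s => Real.sinh (f s)) (Set.Icc t₁ t₂) :=
      Real.continuous_sinh.comp_continuousOn hf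
    have c2 : ContinuousOn (fun s => Real.sinh (2 * f s)) (Set.Icc t₁ t₂) :=
      Real.continuous_sinh.comp_continuousOn (hf.const_mul 2)
    fun_prop
  have hint : ∀ f : ℝ → ℝ, ContinuousOn f (Set.Icc t₁ t₂) →
      IntervalIntegrable f MeasureTheory.volume t₁ t₂ := fun f hf =>
    ContinuousOn.intervalIntegrable (by rwa [Set.uIcc_of_le h₁₂])
  have i1 := hint _ (aux_cont ν Q P h₁ hQc hPc)
  have i2 := hint _ (aux_cont ν q p h₁ hqc hpc)
  have i3 : IntervalIntegrable (fun s => -auxW ν s (q s) * (Q s - q s)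
      + p s * (-(P s)/s - -(p s)/s)) MeasureTheory.volume t₁ t₂ := by
    apply hint
    have := hcW q hqc
    have hs : ∀ s ∈ Set.Icc t₁ t₂, s ≠ 0 := fun s hs => (pos s hs).ne'
    fun_prop (disch := assumption)
  have hftc : ∫ s in t₁..t₂, (-auxW ν s (q s) * (Q s - q s) + p s * (-(P s)/s - -(p s)/s))
      = p t₂ * (Q t₂ - q t₂) - p t₁ * (Q t₁ - q t₁) := by
    refine intervalIntegral.integral_eq_sub_of_hasDerivAt
      (f := fun s => p s * (Q s - q s)) (fun s hs => ?_) i3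
    rw [Set.uIcc_of_le h₁₂] at hs
    have h0 := pos s hs
    exact (hp s h0).mul ((hQ s h0).sub (hq s h0))
  rw [← hftc, ← intervalIntegral.integral_sub i1 i2, ← intervalIntegral.integral_sub (i1.sub i2) i3]
  have := intervalIntegral.norm_integral_le_of_norm_le_const (a := t₁) (b := t₂)
    (C := (1/(2*t₁) + K) * Real.exp (M * (t₂ - t₁)) * ε)
    (f := fun s => -(P s)^2/(2*s) - auxV ν s (Q s) - (-(p s)^2/(2*s) - auxV ν s (q s))
      - (-auxW ν s (q s) * (Q s - q s) + p s * (-(P s)/s - -(p s)/s))) ?_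
  · rw [Real.norm_eq_abs, abs_of_nonneg (sub_nonneg.2 h₁₂)] at this
    refine this.trans (le_of_eq ?_)
    ring
  · intro s hs
    rw [Set.uIoc_of_le h₁₂] at hs
    have hs' := Set.Ioc_subset_Icc_self hs
    have hs0 := pos s hs'
    have hn := hN s hs'
    obtain ⟨b1, b2⟩ := hclose s hs' (hn.trans (hB1 s hs'))
    have hl := (hK s ⟨hs0.le, hs'.2⟩ (q s) (Q s) b1 b2).2
    have hi : 1/(2*s) ≤ 1/(2*t₁) := one_div_le_one_div_of_le (by positivity) (by linarith [hs'.1])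
    have hX : ε * Real.exp (M * (s - t₁)) ≤ ε * Real.exp (M * (t₂ - t₁)) := by
      have := hs'.2
      gcongr
    rw [Real.norm_eq_abs]
    have e : -(P s)^2/(2*s) - auxV ν s (Q s) - (-(p s)^2/(2*s) - auxV ν s (q s))
      - (-auxW ν s (q s) * (Q s - q s) + p s * (-(P s)/s - -(p s)/s))
      = -((1/(2*s)) * (P s - p s)^2)
        + -(auxV ν s (Q s) - auxV ν s (q s) - auxW ν s (q s) * (Q s - q s)) := by
      field_simp
      ring
    rw [e]
    refine (abs_add_le _ _).trans ?_
    rw [abs_neg, abs_neg, abs_of_nonneg (by positivity : 0 ≤ (1/(2*s)) * (P s - p s)^2)]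
    have j1 : (P s - p s)^2 ≤ ε * Real.exp (M * (t₂ - t₁)) := by
      nlinarith [sq_nonneg (Q s - q s)]
    have j2 : (Q s - q s)^2 ≤ ε * Real.exp (M * (t₂ - t₁)) := by
      nlinarith [sq_nonneg (P s - p s)]
    calc _ ≤ (1/(2*t₁)) * (ε * Real.exp (M * (t₂ - t₁)))
            + K * (ε * Real.exp (M * (t₂ - t₁))) := by
          refine add_le_add ?_ (hl.trans ?_)
          · gcongr
          · gcongr
      _ = _ := by ring

/-- Derivative in the parameter of the action between two times. -/
lemma aux_deriv (ν : ℝ) (q p : ℝ → ℝ → ℝ) (A : Set ℝ) {t₁ t₂ l u₁ u₂ : ℝ}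
    (h₁ : 0 < t₁) (h₁₂ : t₁ ≤ t₂) (hl : l ∈ A)
    (hq : ∀ l ∈ A, ∀ t > (0:ℝ), HasDerivAt (fun s => q s l) (-(p t l)/t) t)
    (hp : ∀ l ∈ A, ∀ t > (0:ℝ), HasDerivAt (fun s => p s l) (-auxW ν t (q t l)) t)
    (hu₁ : HasDerivAt (fun l' => q t₁ l') u₁ l) (hu₂ : HasDerivAt (fun l' => q t₂ l') u₂ l)
    (hpl : DifferentiableAt ℝ (fun l' => p t₁ l') l) :
    HasDerivWithinAt (fun l' => ∫ s in t₁..t₂, (-(p s l')^2/(2*s) - auxV ν s (q s l')))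
      (p t₂ l * u₂ - p t₁ l * u₁) A l := by
  obtain ⟨C, η, hη, hC⟩ := aux_variation ν (fun s => q s l) (fun s => p s l) h₁ h₁₂
    (hq l hl) (hp l hl)
  set F : ℝ → ℝ := fun l' => ∫ s in t₁..t₂, (-(p s l')^2/(2*s) - auxV ν s (q s l')) with hF
  set G : ℝ → ℝ := fun l' => p t₂ l * q t₂ l' - p t₁ l * q t₁ l' with hG
  have hGd : HasDerivAt G (p t₂ l * u₂ - p t₁ l * u₁) l :=
    (hu₂.const_mul _).sub (hu₁.const_mul _)
  have hsmall : HasDerivWithinAt (fun l' => F l' - G l') 0 A l := by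
    set E : ℝ → ℝ := fun l' => (q t₁ l' - q t₁ l)^2 + (p t₁ l' - p t₁ l)^2 + (l' - l)^2 with hE
    have hEd : HasDerivAt E 0 l := by
      have := (((hu₁.sub_const (q t₁ l)).pow 2).add ((hpl.hasDerivAt.sub_const (p t₁ l)).pow 2)).add
        (((hasDerivAt_id l).sub_const l).pow 2)
      refine this.congr_deriv ?_
      simp
    have hE0 : E l = 0 := by simp [hE]
    have hEo : (fun l' => E l') =o[nhds l] fun l' => l' - l := by
      have := hasDerivAt_iff_isLittleO.1 hEd
      simpa [hE0] using this
    rw [hasDerivWithinAt_iff_isLittleO]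
    simp only [smul_zero, sub_zero]
    refine Asymptotics.IsBigO.trans_isLittleO ?_ (hEo.mono nhdsWithin_le_nhds)
    refine Asymptotics.IsBigO.of_bound C ?_
    have hev : ∀ᶠ l' in nhdsWithin l A, E l' < η :=
      nhdsWithin_le_nhds (hEd.continuousAt.eventually_lt_const (by rw [hE0]; exact hη))
    filter_upwards [hev, self_mem_nhdsWithin] with l' h1 h2
    by_cases hll : l' = l
    · subst hll
      simp [hE0]
    · have hpos : 0 < (l' - l)^2 := by
        have : l' - l ≠ 0 := sub_ne_zero.2 hll
        positivity
      have hEpos : 0 < E l' := by simp only [hE]; positivity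
      have := hC (fun s => q s l') (fun s => p s l') (hq l' h2) (hp l' h2) (E l') hEpos h1.le
        (by simp only [hE]; linarith)
      rw [Real.norm_eq_abs, Real.norm_eq_abs, abs_of_pos hEpos]
      refine le_trans (le_of_eq ?_) this
      congr 1
      simp only [hF, hG]
      ring
  have := hsmall.add hGd.hasDerivWithinAt
  rw [zero_add] at this
  refine this.congr_of_eventuallyEq ?_ ?_
  · exact Filter.Eventually.of_forall fun x => by simp
  · simp

theorem stmt2 (ν lam₀ : ℝ) (hlam₀ : 0 < lam₀)
    (q p qt qlam : ℝ → ℝ → ℝ)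
    -- (i) Hamiltonian system in t, for each λ ∈ [0,lam₀]
    (hqt : ∀ l ∈ Set.Icc (0:ℝ) lam₀, ∀ t > (0:ℝ), HasDerivAt (fun t' => q t' l) (qt t l) t)
    (hqt' : ∀ l ∈ Set.Icc (0:ℝ) lam₀, ∀ t > (0:ℝ), qt t l = -(p t l) / t)
    (hp : ∀ l ∈ Set.Icc (0:ℝ) lam₀, ∀ t > (0:ℝ), HasDerivAt (fun t' => p t' l)
      (-(t/2) * Real.sinh (2 * q t l) - 2 * ν * Real.sinh (q t l)) t)
    -- (ii) differentiability in λ and equality of mixed partials of q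
    (hqlam : ∀ t > (0:ℝ), ∀ l ∈ Set.Icc (0:ℝ) lam₀,
      HasDerivAt (fun l' => q t l') (qlam t l) l)
    (hplam : ∀ t > (0:ℝ), ∀ l ∈ Set.Icc (0:ℝ) lam₀,
      DifferentiableAt ℝ (fun l' => p t l') l)
    (hmix : ∀ t > (0:ℝ), ∀ l ∈ Set.Icc (0:ℝ) lam₀,
      HasDerivAt (fun l' => qt t l') (deriv (fun t' => qlam t' l) t) l)
    -- (iii) vanishing at λ = 0
    (hq0 : ∀ t > (0:ℝ), q t 0 = 0) (hp0 : ∀ t > (0:ℝ), p t 0 = 0)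
    -- (iv) absolute convergence of the action integral and differentiation under it
    (hSint : ∀ t > (0:ℝ), ∀ l ∈ Set.Icc (0:ℝ) lam₀,
      MeasureTheory.IntegrableOn (fun s => p s l * qt s l - Ham ν q p s l) (Set.Ioi t))
    (hleib : ∀ t > (0:ℝ), ∀ l ∈ Set.Icc (0:ℝ) lam₀,
      HasDerivAt (fun l' => ∫ s in Set.Ioi t, (p s l' * qt s l' - Ham ν q p s l'))
        (∫ s in Set.Ioi t, deriv (fun l' => p s l' * qt s l' - Ham ν q p s l') l) l)
    -- (v) decay of p·∂q/∂λ at t = +∞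
    (hdecay : ∀ l ∈ Set.Icc (0:ℝ) lam₀,
      Filter.Tendsto (fun s => p s l * qlam s l) Filter.atTop (nhds 0))
    -- (vi) continuity in λ of p·∂q/∂λ
    (hcont : ∀ t > (0:ℝ), ContinuousOn (fun l' => p t l' * qlam t l') (Set.Icc 0 lam₀)) :
    ∀ t > (0:ℝ), ∀ l ∈ Set.Icc (0:ℝ) lam₀,
      (∫ s in Set.Ioi t, (p s l * qt s l - Ham ν q p s l))
        = -∫ l' in (0:ℝ)..l, p t l' * qlam t l' := by
  have hL : ∀ l ∈ Set.Icc (0:ℝ) lam₀, ∀ s > (0:ℝ), p s l * qt s l - Ham ν q p s l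
      = -(p s l)^2/(2*s) - auxV ν s (q s l) := by
    intro l hl s hs
    rw [hqt' l hl s hs]
    unfold Ham auxV
    field_simp
    ring
  have hq' : ∀ l ∈ Set.Icc (0:ℝ) lam₀, ∀ t > (0:ℝ),
      HasDerivAt (fun s => q s l) (-(p t l)/t) t := fun l hl t ht => by
    rw [← hqt' l hl t ht]; exact hqt l hl t ht
  have hp' : ∀ l ∈ Set.Icc (0:ℝ) lam₀, ∀ t > (0:ℝ),
      HasDerivAt (fun s => p s l) (-auxW ν t (q t l)) t := fun l hl t ht => by
    refine (hp l hl t ht).congr_deriv ?_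
    unfold auxW; ring
  set S : ℝ → ℝ → ℝ := fun t l => ∫ s in Set.Ioi t, (p s l * qt s l - Ham ν q p s l) with hS
  set D : ℝ → ℝ → ℝ := fun t l =>
    ∫ s in Set.Ioi t, deriv (fun l' => p s l' * qt s l' - Ham ν q p s l') l with hD
  have hdiff : ∀ l ∈ Set.Icc (0:ℝ) lam₀, ∀ t₁ > (0:ℝ), ∀ t₂, t₁ ≤ t₂ →
      D t₁ l - D t₂ l = p t₂ l * qlam t₂ l - p t₁ l * qlam t₁ l := by
    intro l hl t₁ h₁ t₂ h₁₂
    have h₂ : 0 < t₂ := h₁.trans_le h₁₂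
    have a := aux_deriv ν q p (Set.Icc 0 lam₀) h₁ h₁₂ hl hq' hp' (hqlam t₁ h₁ l hl)
      (hqlam t₂ h₂ l hl) (hplam t₁ h₁ l hl)
    have b : HasDerivWithinAt (fun l' => S t₁ l' - S t₂ l') (D t₁ l - D t₂ l)
        (Set.Icc 0 lam₀) l := ((hleib t₁ h₁ l hl).sub (hleib t₂ h₂ l hl)).hasDerivWithinAt
    have hEq : ∀ l' ∈ Set.Icc (0:ℝ) lam₀, S t₁ l' - S t₂ l'
        = ∫ s in t₁..t₂, (-(p s l')^2/(2*s) - auxV ν s (q s l')) := by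
      intro l' hl'
      rw [hS]
      simp only
      rw [intervalIntegral.integral_Ioi_sub_Ioi (hSint t₁ h₁ l' hl') h₁₂]
      refine intervalIntegral.integral_congr fun s hs => ?_
      rw [Set.uIcc_of_le h₁₂] at hs
      exact hL l' hl' s (h₁.trans_le hs.1)
    exact (uniqueDiffOn_Icc hlam₀ l hl).eq_deriv _ b (a.congr hEq (hEq l hl))
  have hDval : ∀ l ∈ Set.Icc (0:ℝ) lam₀, ∀ t > (0:ℝ), D t l = -(p t l * qlam t l) := by
    intro l hl t ht
    have hD0 : Filter.Tendsto (fun T => D T l) Filter.atTop (nhds 0) := by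
      by_cases hI : ∃ T₀ : ℝ, MeasureTheory.IntegrableOn
          (fun s => deriv (fun l' => p s l' * qt s l' - Ham ν q p s l') l) (Set.Ioi T₀)
      · obtain ⟨T₀, hT₀⟩ := hI
        have h1 := MeasureTheory.intervalIntegral_tendsto_integral_Ioi T₀ hT₀ Filter.tendsto_id
        have h2 := (tendsto_const_nhds (x := D T₀ l)).sub h1
        rw [show D T₀ l - ∫ x in Set.Ioi T₀,
          deriv (fun l' => p x l' * qt x l' - Ham ν q p x l') l = 0 from sub_self _] at h2
        refine h2.congr' ?_
        filter_upwards [Filter.eventually_ge_atTop T₀] with T hT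
        have := intervalIntegral.integral_Ioi_sub_Ioi hT₀ hT
        simp only [hD, id]
        linarith
      · push Not at hI
        refine tendsto_const_nhds.congr fun T => ?_
        exact (MeasureTheory.integral_undef (hI T)).symm
    have h3 : Filter.Tendsto (fun T => D T l + p T l * qlam T l) Filter.atTop (nhds (0 + 0)) :=
      hD0.add (hdecay l hl)
    have h4 : Filter.Tendsto (fun T => D T l + p T l * qlam T l) Filter.atTop
        (nhds (D t l + p t l * qlam t l)) := by
      refine tendsto_const_nhds.congr' ?_
      filter_upwards [Filter.eventually_ge_atTop t] with T hT
      have := hdiff l hl t ht T hT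
      linarith
    have := tendsto_nhds_unique h3 h4
    linarith
  intro t ht l hl
  have hsub : Set.uIcc 0 l ⊆ Set.Icc 0 lam₀ := by
    rw [Set.uIcc_of_le hl.1]
    exact Set.Icc_subset_Icc le_rfl hl.2
  have hftc : ∫ l' in (0:ℝ)..l, -(p t l' * qlam t l') = S t l - S t 0 := by
    refine intervalIntegral.integral_eq_sub_of_hasDerivAt (f := S t) (fun x hx => ?_) ?_
    · rw [← hDval x (hsub hx) t ht]
      exact hleib t ht x (hsub hx)
    · exact ((hcont t ht).mono hsub).neg.intervalIntegrable
  have h0 : S t 0 = 0 := by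
    refine MeasureTheory.setIntegral_eq_zero_of_forall_eq_zero fun s hs => ?_
    have hs0 : 0 < s := ht.trans hs
    simp [Ham, hq0 s hs0, hp0 s hs0]
  rw [intervalIntegral.integral_neg, h0, sub_zero] at hftc
  exact hftc.symm
end

section
/- Let λ ∈ ℝ, let I ⊆ ℝ be an open interval, and let q, p : (0,∞) × I → ℝ be such that: (i) for each ν ∈ I, the functions t ↦ q(t,ν), t ↦ p(t,ν) are differentiable and solve the Hamiltonian system ∂q/∂t = −p/t, ∂p/∂t = −(t/2)·sinh(2q) − 2ν·sinh(q); (ii) q and p are differentiable in ν, with the mixed partial derivatives of q equal: ∂²q/∂ν∂t = ∂²q/∂t∂ν; (iii) for each t > 0 and ν ∈ I the integral S(t,ν) := ∫ₜ^∞ (p(s,ν)·∂q/∂s(s,ν) − H(s,ν)) ds converges absolutely, ν ↦ S(t,ν) is differentiable, and differentiation under the integral sign is valid: ∂S/∂ν(t,ν) = ∫ₜ^∞ ∂/∂ν[p·∂q/∂s − H(·,·,s,ν)](s,ν) ds; (iv) p(s,ν)·∂q/∂ν(s,ν) → 0 as s → +∞; (v) s ↦ sinh²(q(s,ν)/2)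 is integrable on (t,∞) for every t > 0. Then for all t > 0 and ν ∈ I: ∫ₜ^∞ sinh²(q(s,ν)/2) ds = −(1/4)·[p(t,ν)·(∂q/∂ν)(t,ν) + (∂S/∂ν)(t,ν)]. -/
/- STATEMENT 3 (Corollary 2.3): expressing ∫ₜ^∞ sinh²(q/2) ds through the
ν-derivative of the action integral. -/

/-- The Hamiltonian `H(q,p,t,ν)` evaluated along a family of solutions `(q,p)`
depending on the parameter ν (second argument). -/
noncomputable def Ham2 (q p : ℝ → ℝ → ℝ) (t ν : ℝ) : ℝ :=
  t/2 * Real.sinh (q t ν) ^ 2 - (p t ν) ^ 2 / (2 * t) + 4 * ν * Real.sinh (q t ν / 2) ^ 2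

theorem cor23_sinh_lip {M x y : ℝ} (hx : |x| ≤ M) (hy : |y| ≤ M) :
    |Real.sinh x - Real.sinh y| ≤ Real.cosh M * |x - y| := by
  have hM : 0 ≤ M := (abs_nonneg x).trans hx
  have := Convex.norm_image_sub_le_of_norm_hasDerivWithin_le (f := Real.sinh) (f' := Real.cosh)
    (s := Set.Icc (-M) M) (C := Real.cosh M) (x := y) (y := x)
    (fun z _ => (Real.hasDerivAt_sinh z).hasDerivWithinAt)
    (fun z hz => by
      rw [Real.norm_eq_abs, abs_of_pos (Real.cosh_pos z), Real.cosh_le_cosh, abs_of_nonneg hM]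
      exact abs_le.2 hz)
    (convex_Icc _ _) (abs_le.1 hy) (abs_le.1 hx)
  simpa [Real.norm_eq_abs] using this

/-- one-sided maximum principle -/
theorem cor23_max {a b ν M : ℝ} (ha : 0 < a) (hab : a ≤ b) (q p : ℝ → ℝ)
    (hq : ∀ s ∈ Set.Icc a b, HasDerivAt q (-(p s) / s) s)
    (hp : ∀ s ∈ Set.Icc a b, HasDerivAt p
      (-(s/2) * Real.sinh (2 * q s) - 2 * ν * Real.sinh (q s)) s)
    (hM : 0 ≤ M) (hqa : q a ≤ M) (hqb : q b ≤ M) (hν : 2 * |ν| ≤ a * M) :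
    ∀ s ∈ Set.Icc a b, q s ≤ M := by
  obtain ⟨m, hm, hmax⟩ := isCompact_Icc.exists_isMaxOn (Set.nonempty_Icc.2 hab)
    (fun s hs => (hq s hs).continuousAt.continuousWithinAt : ContinuousOn q (Set.Icc a b))
  by_contra! hcon
  obtain ⟨s, hs, hsM⟩ := hcon
  have hqm : M < q m := lt_of_lt_of_le hsM (hmax hs)
  have hma : a < m := lt_of_le_of_ne hm.1 (by rintro rfl; linarith)
  have hmb : m < b := lt_of_le_of_ne hm.2 (by rintro rfl; linarith)
  have hm0 : 0 < m := ha.trans hma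
  have hloc : IsLocalMax q m := hmax.isLocalMax (Icc_mem_nhds hma hmb)
  have hpm : p m = 0 := by
    have := hloc.hasDerivAt_eq_zero (hq m hm)
    rw [div_eq_zero_iff] at this
    rcases this with h | h
    · linarith
    · linarith
  have hsinh : 0 < Real.sinh (q m) := Real.sinh_pos_iff.2 (by linarith)
  have hcosh : M < Real.cosh (q m) := by
    have h1 := Real.self_le_sinh_iff.2 (by linarith : 0 ≤ q m)
    have h2 := Real.sinh_lt_cosh (q m)
    linarith
  have hneg : -(m/2) * Real.sinh (2 * q m) - 2 * ν * Real.sinh (q m) < 0 := by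
    rw [Real.sinh_two_mul]
    have h3 : 0 < m * Real.cosh (q m) + 2 * ν := by
      have := neg_abs_le ν
      have h4 : a * M < m * Real.cosh (q m) := by
        have : a * M ≤ m * M := by gcongr
        have : m * M < m * Real.cosh (q m) := by gcongr
        linarith
      linarith
    nlinarith [mul_pos hsinh h3]
  have hd : deriv p m < 0 := by rw [(hp m hm).deriv]; exact hneg
  have hev : ∀ᶠ x in nhdsWithin m (Set.Ioi m), p x < 0 := by
    have h := (hp m hm).hasDerivWithinAt (s := Set.Ioi m)
    have h' := (h.limsup_slope_le' (by simp) hneg)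
    filter_upwards [h', self_mem_nhdsWithin] with x hx hx'
    rw [slope_def_field, hpm, sub_zero] at hx
    have : 0 < x - m := sub_pos.2 hx'
    by_contra! hc
    exact absurd hx (not_lt.2 (div_nonneg hc this.le))
  obtain ⟨u, hu, hu'⟩ := mem_nhdsGT_iff_exists_Ioo_subset.1 hev
  have hu : m < u := hu
  set c := min u b with hc
  have hmc : m < c := lt_min hu hmb
  have hsub : Set.Icc m c ⊆ Set.Icc a b := fun x hx =>
    ⟨hma.le.trans hx.1, hx.2.trans (min_le_right _ _)⟩
  have hmono : StrictMonoOn q (Set.Icc m c) := by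
    apply strictMonoOn_of_deriv_pos (convex_Icc _ _)
    · exact fun s hs => (hq s (hsub hs)).continuousAt.continuousWithinAt
    · intro x hx
      rw [interior_Icc] at hx
      rw [(hq x (hsub ⟨hx.1.le, hx.2.le⟩)).deriv]
      have h5 : p x < 0 := hu' ⟨hx.1, hx.2.trans_le (min_le_left _ _)⟩
      exact div_pos (by linarith) (hm0.trans hx.1)
  have h6 := hmono (Set.left_mem_Icc.2 hmc.le) (Set.right_mem_Icc.2 hmc.le) hmc
  have h7 : q c ≤ q m := hmax (hsub (Set.right_mem_Icc.2 hmc.le))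
  linarith

theorem cor23_abs {a b ν M : ℝ} (ha : 0 < a) (hab : a ≤ b) (q p : ℝ → ℝ)
    (hq : ∀ s ∈ Set.Icc a b, HasDerivAt q (-(p s) / s) s)
    (hp : ∀ s ∈ Set.Icc a b, HasDerivAt p
      (-(s/2) * Real.sinh (2 * q s) - 2 * ν * Real.sinh (q s)) s)
    (hM : 0 ≤ M) (hqa : |q a| ≤ M) (hqb : |q b| ≤ M) (hν : 2 * |ν| ≤ a * M) :
    ∀ s ∈ Set.Icc a b, |q s| ≤ M := by
  intro s hs
  rw [abs_le] at hqa hqb ⊢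
  refine ⟨?_, cor23_max ha hab q p hq hp hM hqa.2 hqb.2 hν s hs⟩
  have := cor23_max (ν := ν) ha hab (fun s => - q s) (fun s => - p s)
    (fun s hs => (hq s hs).neg.congr_deriv (by ring))
    (fun s hs => (hp s hs).neg.congr_deriv (by
      rw [mul_neg, Real.sinh_neg, Real.sinh_neg]; ring)) hM
    (by linarith [hqa.1]) (by linarith [hqb.1]) hν s hs
  linarith

theorem cor23_gronwall {a b ν ν0 M N C0 : ℝ} (ha : 0 < a) (hab : a ≤ b) (q p q0 p0 : ℝ → ℝ)
    (hq : ∀ s ∈ Set.Icc a b, HasDerivAt q (-(p s) / s) s)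
    (hp : ∀ s ∈ Set.Icc a b, HasDerivAt p
      (-(s/2) * Real.sinh (2 * q s) - 2 * ν * Real.sinh (q s)) s)
    (hq0 : ∀ s ∈ Set.Icc a b, HasDerivAt q0 (-(p0 s) / s) s)
    (hp0 : ∀ s ∈ Set.Icc a b, HasDerivAt p0
      (-(s/2) * Real.sinh (2 * q0 s) - 2 * ν0 * Real.sinh (q0 s)) s)
    (hM : ∀ s ∈ Set.Icc a b, |q s| ≤ M) (hM0 : ∀ s ∈ Set.Icc a b, |q0 s| ≤ M)
    (hN : |ν| ≤ N) (hC : 0 ≤ C0)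
    (hqa : |q a - q0 a| ≤ C0 * |ν - ν0|) (hpa : |p a - p0 a| ≤ C0 * |ν - ν0|) :
    ∀ s ∈ Set.Icc a b, 
      |q s - q0 s| ≤ ((C0 + 2 * Real.cosh M / (1/a + b * Real.cosh (2*M) + 2 * N * Real.cosh M)) *
        Real.exp ((1/a + b * Real.cosh (2*M) + 2 * N * Real.cosh M) * (b - a))) * |ν - ν0| ∧ 
      |p s - p0 s| ≤ ((C0 + 2 * Real.cosh M / (1/a + b * Real.cosh (2*M) + 2 * N * Real.cosh M)) *
        Real.exp ((1/a + b * Real.cosh (2*M) + 2 * N * Real.cosh M) * (b - a))) * |ν - ν0| := by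
  have hN0 : 0 ≤ N := (abs_nonneg _).trans hN
  have hb : 0 < b := by linarith
  set K := 1/a + b * Real.cosh (2*M) + 2 * N * Real.cosh M with hK
  have hcM := Real.cosh_pos M
  have hc2M := Real.cosh_pos (2 * M)
  have hK0 : 0 < K := by positivity
  have key := norm_le_gronwallBound_of_norm_deriv_right_le (E := ℝ × ℝ) (a := a) (b := b)
    (f := fun s => (q s - q0 s, p s - p0 s))
    (f' := fun s => (-(p s) / s - -(p0 s) / s,
      (-(s/2) * Real.sinh (2 * q s) - 2 * ν * Real.sinh (q s)) -
      (-(s/2) * Real.sinh (2 * q0 s) - 2 * ν0 * Real.sinh (q0 s))))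
    (δ := C0 * |ν - ν0|) (K := K) (ε := 2 * Real.cosh M * |ν - ν0|)
    (fun s hs => (((hq s hs).sub (hq0 s hs)).prodMk
      ((hp s hs).sub (hp0 s hs))).continuousAt.continuousWithinAt)
    (fun s hs => (((hq s ⟨hs.1, hs.2.le⟩).sub (hq0 s ⟨hs.1, hs.2.le⟩)).prodMk
      ((hp s ⟨hs.1, hs.2.le⟩).sub (hp0 s ⟨hs.1, hs.2.le⟩))).hasDerivWithinAt)
    (by rw [Prod.norm_def]; exact max_le hqa hpa)
    (by
      intro s hs
      have hs' : s ∈ Set.Icc a b := ⟨hs.1, hs.2.le⟩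
      have hs0 : 0 < s := ha.trans_le hs.1
      set n := ‖(q s - q0 s, p s - p0 s)‖ with hn
      have h1 : |q s - q0 s| ≤ n := norm_fst_le (q s - q0 s, p s - p0 s)
      have h2 : |p s - p0 s| ≤ n := norm_snd_le (q s - q0 s, p s - p0 s)
      have hn0 : 0 ≤ n := norm_nonneg _
      rw [Prod.norm_def]
      apply max_le
      · have e : -(p s) / s - -(p0 s) / s = -((p s - p0 s) / s) := by ring
        simp only [Real.norm_eq_abs]
        rw [e, abs_neg, abs_div, abs_of_pos hs0]
        have : |p s - p0 s| / s ≤ n / a := div_le_div₀ hn0 h2 ha hs.1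
        have : 0 ≤ (b * Real.cosh (2*M) + 2 * N * Real.cosh M) * n := by positivity
        have : 0 ≤ 2 * Real.cosh M * |ν - ν0| := by positivity
        have : K * n = n / a + (b * Real.cosh (2*M) + 2 * N * Real.cosh M) * n := by
          rw [hK]; ring
        linarith
      · have e : (-(s/2) * Real.sinh (2 * q s) - 2 * ν * Real.sinh (q s)) -
            (-(s/2) * Real.sinh (2 * q0 s) - 2 * ν0 * Real.sinh (q0 s)) =
            -(s/2 * (Real.sinh (2 * q s) - Real.sinh (2 * q0 s))) +
            -(2 * ν * (Real.sinh (q s) - Real.sinh (q0 s))) +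
            -(2 * (ν - ν0) * Real.sinh (q0 s)) := by ring
        simp only [Real.norm_eq_abs]
        rw [e]
        refine (abs_add_three _ _ _).trans ?_
        simp only [abs_neg, abs_mul]
        rw [abs_of_pos (by positivity : 0 < s / 2), abs_two]
        have g1 := cor23_sinh_lip (hM s hs') (hM0 s hs')
        have g2 : |Real.sinh (2 * q s) - Real.sinh (2 * q0 s)| ≤
            Real.cosh (2 * M) * |2 * q s - 2 * q0 s| :=
          cor23_sinh_lip (by rw [abs_mul, abs_two]; linarith [hM s hs'])
            (by rw [abs_mul, abs_two]; linarith [hM0 s hs'])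
        rw [← mul_sub, abs_mul, abs_two] at g2
        have g3 : |Real.sinh (q0 s)| ≤ Real.cosh M := by
          rw [Real.abs_sinh]
          have := Real.sinh_le_sinh.2 (hM0 s hs')
          linarith [Real.sinh_lt_cosh M]
        have t1 : s / 2 * |Real.sinh (2 * q s) - Real.sinh (2 * q0 s)| ≤
            b / 2 * (Real.cosh (2 * M) * (2 * n)) := by
          have := hs.2.le
          refine mul_le_mul (by linarith) (g2.trans ?_) (abs_nonneg _) (by positivity)
          gcongr
        have t2 : 2 * |ν| * |Real.sinh (q s) - Real.sinh (q0 s)| ≤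
            2 * N * (Real.cosh M * n) := by
          refine mul_le_mul (by linarith) (g1.trans ?_) (abs_nonneg _) (by positivity)
          gcongr
        have t3 : 2 * |ν - ν0| * |Real.sinh (q0 s)| ≤ 2 * |ν - ν0| * Real.cosh M := by gcongr
        have : 0 ≤ n / a := by positivity
        have : K * n = n / a + (b * Real.cosh (2*M) + 2 * N * Real.cosh M) * n := by
          rw [hK]; ring
        linarith)
  intro s hs
  have h := key s hs
  have hle : gronwallBound (C0 * |ν - ν0|) K (2 * Real.cosh M * |ν - ν0|) (s - a) ≤
      ((C0 + 2 * Real.cosh M / K) * Real.exp (K * (b - a))) * |ν - ν0| := by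
    rw [gronwallBound_of_K_ne_0 hK0.ne']
    have h1 : Real.exp (K * (s - a)) ≤ Real.exp (K * (b - a)) := by
      apply Real.exp_le_exp.2; have := hs.2; gcongr
    have h2 : 0 ≤ 2 * Real.cosh M * |ν - ν0| / K := by positivity
    have h3 : 0 ≤ C0 * |ν - ν0| := by positivity
    calc _ ≤ C0 * |ν - ν0| * Real.exp (K * (b - a)) +
          2 * Real.cosh M * |ν - ν0| / K * Real.exp (K * (b - a)) := by
            apply add_le_add
            · gcongr
            · apply mul_le_mul_of_nonneg_left _ h2; linarith
      _ = _ := by ring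
  exact ⟨(norm_fst_le (q s - q0 s, p s - p0 s)).trans (h.trans hle),
    (norm_snd_le (q s - q0 s, p s - p0 s)).trans (h.trans hle)⟩

open Filter Topology MeasureTheory

def Cor23Good (f : ℝ → ℝ → ℝ) (a b ν0 : ℝ) : Prop :=
  (∀ᶠ ν in 𝓝 ν0, ContinuousOn (fun s => f s ν) (Set.Icc a b)) ∧
  ∃ C, 0 ≤ C ∧ (∀ s ∈ Set.Icc a b, |f s ν0| ≤ C) ∧
    ∀ᶠ ν in 𝓝 ν0, ∀ s ∈ Set.Icc a b, |f s ν| ≤ C + C ∧ |f s ν - f s ν0| ≤ C * |ν - ν0|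

theorem Cor23Good.mk' {f : ℝ → ℝ → ℝ} {a b ν0 C : ℝ}
    (hc : ∀ᶠ ν in 𝓝 ν0, ContinuousOn (fun s => f s ν) (Set.Icc a b))
    (h : ∀ᶠ ν in 𝓝 ν0, ∀ s ∈ Set.Icc a b, |f s ν - f s ν0| ≤ C * |ν - ν0|) :
    Cor23Good f a b ν0 := by
  refine ⟨hc, ?_⟩
  obtain ⟨B, hB⟩ := isCompact_Icc.exists_bound_of_continuousOn hc.self_of_nhds
  refine ⟨max (max C B) 0, le_max_right _ _, fun s hs => (hB s hs).trans
    ((le_max_right _ _).trans (le_max_left _ _)), ?_⟩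
  have h1 : ∀ᶠ ν in 𝓝 ν0, |ν - ν0| < 1 := by
    have := Metric.ball_mem_nhds ν0 one_pos
    filter_upwards [this] with ν hν
    simpa [Real.dist_eq] using hν
  filter_upwards [h, h1] with ν hν h1 s hs
  have h2 : |f s ν - f s ν0| ≤ max (max C B) 0 * |ν - ν0| := (hν s hs).trans (by
    gcongr
    exact (le_max_left _ _).trans (le_max_left _ _))
  refine ⟨?_, h2⟩
  have h3 : |f s ν0| ≤ max (max C B) 0 := (hB s hs).trans
    ((le_max_right _ _).trans (le_max_left _ _))
  have h4 : max (max C B) 0 * |ν - ν0| ≤ max (max C B) 0 :=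
    mul_le_of_le_one_right (le_max_right _ _) h1.le
  have h5 : |f s ν| ≤ |f s ν - f s ν0| + |f s ν0| := by
    simpa using abs_add_le (f s ν - f s ν0) (f s ν0)
  linarith

theorem Cor23Good.indep {g : ℝ → ℝ} {a b ν0 : ℝ} (hg : ContinuousOn g (Set.Icc a b)) :
    Cor23Good (fun s _ => g s) a b ν0 :=
  .mk' (C := 0) (.of_forall fun _ => hg) (.of_forall fun _ s _ => by simp)

theorem Cor23Good.param {a b ν0 : ℝ} : Cor23Good (fun _ ν => ν) a b ν0 :=
  .mk' (C := 1) (.of_forall fun _ => continuousOn_const) (.of_forall fun _ s _ => by simp)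

theorem Cor23Good.add {f g : ℝ → ℝ → ℝ} {a b ν0 : ℝ} (hf : Cor23Good f a b ν0)
    (hg : Cor23Good g a b ν0) : Cor23Good (fun s ν => f s ν + g s ν) a b ν0 := by
  obtain ⟨fc, C, hC, hf0, hf⟩ := hf
  obtain ⟨gc, D, hD, hg0, hg⟩ := hg
  refine .mk' (C := C + D) ?_ ?_
  · filter_upwards [fc, gc] with ν h1 h2 using h1.add h2
  · filter_upwards [hf, hg] with ν h1 h2 s hs
    have e : f s ν + g s ν - (f s ν0 + g s ν0) = (f s ν - f s ν0) + (g s ν - g s ν0) := by ring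
    rw [e]
    refine (abs_add_le _ _).trans ?_
    linarith [(h1 s hs).2, (h2 s hs).2]

theorem Cor23Good.mul {f g : ℝ → ℝ → ℝ} {a b ν0 : ℝ} (hf : Cor23Good f a b ν0)
    (hg : Cor23Good g a b ν0) : Cor23Good (fun s ν => f s ν * g s ν) a b ν0 := by
  obtain ⟨fc, C, hC, hf0, hf⟩ := hf
  obtain ⟨gc, D, hD, hg0, hg⟩ := hg
  refine .mk' (C := (C + C) * D + C * D) ?_ ?_
  · filter_upwards [fc, gc] with ν h1 h2 using h1.mul h2
  · filter_upwards [hf, hg] with ν h1 h2 s hs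
    have e : f s ν * g s ν - (f s ν0 * g s ν0) =
      f s ν * (g s ν - g s ν0) + (f s ν - f s ν0) * g s ν0 := by ring
    rw [e]
    refine (abs_add_le _ _).trans ?_
    rw [abs_mul, abs_mul]
    have t1 := mul_le_mul (h1 s hs).1 (h2 s hs).2 (abs_nonneg _) (by linarith)
    have t2 := mul_le_mul (h1 s hs).2 (hg0 s hs) (abs_nonneg _) (by positivity)
    linarith

theorem Cor23Good.sinh {f : ℝ → ℝ → ℝ} {a b ν0 : ℝ} (hf : Cor23Good f a b ν0) :
    Cor23Good (fun s ν => Real.sinh (f s ν)) a b ν0 := by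
  obtain ⟨fc, C, hC, hf0, hf⟩ := hf
  refine .mk' (C := Real.cosh (C + C) * C) ?_ ?_
  · filter_upwards [fc] with ν h1 using Real.continuous_sinh.comp_continuousOn h1
  · filter_upwards [hf] with ν h1 s hs
    refine (cor23_sinh_lip (h1 s hs).1 ((hf0 s hs).trans (by linarith))).trans ?_
    rw [mul_assoc]
    exact mul_le_mul_of_nonneg_left (h1 s hs).2 (Real.cosh_pos _).le

theorem Cor23Good.leibniz {f : ℝ → ℝ → ℝ} {a b ν0 : ℝ} (hf : Cor23Good f a b ν0) (hab : a ≤ b)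
    (f' : ℝ → ℝ) (hd : ∀ s ∈ Set.Icc a b, HasDerivAt (fun ν => f s ν) (f' s) ν0) :
    IntervalIntegrable f' volume a b ∧
    HasDerivAt (fun ν => ∫ s in a..b, f s ν) (∫ s in a..b, f' s) ν0 := by
  obtain ⟨fc, C, hC, hf0, hf⟩ := hf
  have hmem : ∀ᵐ s ∂(volume.restrict (Set.Ioc a b)), s ∈ Set.Icc a b := by
    filter_upwards [ae_restrict_mem measurableSet_Ioc] with s hs using ⟨hs.1.le, hs.2⟩
  have hfInt : ∀ᶠ ν in 𝓝 ν0, Integrable (fun s => f s ν) (volume.restrict (Set.Ioc a b)) := by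
    filter_upwards [fc] with ν h
    exact (h.integrableOn_Icc).mono_set Set.Ioc_subset_Icc_self
  have hmeas : AEStronglyMeasurable f' (volume.restrict (Set.Ioc a b)) := by
    obtain ⟨δ, hδ, hδ'⟩ := Metric.eventually_nhds_iff.1 hfInt
    have hu : Tendsto (fun n : ℕ => ν0 + δ / 2 * (1 / ((n : ℝ) + 1))) atTop (𝓝[≠] ν0) := by
      apply tendsto_nhdsWithin_of_tendsto_nhds_of_eventually_within
      · simpa using (tendsto_one_div_add_atTop_nhds_zero_nat (𝕜 := ℝ)).const_mul (δ/2) |>.const_add ν0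
      · refine .of_forall fun n => ?_
        have : 0 < δ / 2 * (1 / ((n : ℝ) + 1)) := by positivity
        simp only [Set.mem_compl_iff, Set.mem_singleton_iff]
        linarith
    refine aestronglyMeasurable_of_tendsto_ae (u := atTop)
      (f := fun (n : ℕ) s => slope (fun ν => f s ν) ν0 (ν0 + δ / 2 * (1 / ((n : ℝ) + 1)))) ?_ ?_
    · intro n
      simp only [slope_def_field]
      have h1 : Integrable (fun s => f s (ν0 + δ / 2 * (1 / ((n : ℝ) + 1))))
          (volume.restrict (Set.Ioc a b)) := by
        apply hδ'
        have h0 : 0 < δ / 2 * (1 / ((n : ℝ) + 1)) := by positivity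
        have h2 : (1 / ((n : ℝ) + 1)) ≤ 1 := by
          rw [div_le_one (by positivity)]; linarith [n.cast_nonneg (α := ℝ)]
        rw [Real.dist_eq, add_sub_cancel_left, abs_of_pos h0]
        nlinarith
      exact ((h1.sub hfInt.self_of_nhds).div_const _).aestronglyMeasurable
    · filter_upwards [hmem] with s hs
      exact (hasDerivAt_iff_tendsto_slope.1 (hd s hs)).comp hu
  set L : ℝ →L[ℝ] ℝ →L[ℝ] ℝ := ContinuousLinearMap.smulRightL ℝ ℝ ℝ 1
  have hm : AEStronglyMeasurable (L ∘ f') (volume.restrict (Set.Ioc a b)) :=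
    L.continuous.comp_aestronglyMeasurable hmeas
  have hbd : ∀ᵐ s ∂(volume.restrict (Set.Ioc a b)), ‖f' s‖ ≤ C := by
    filter_upwards [hmem] with s hs
    refine (hd s hs).le_of_lip' hC ?_
    filter_upwards [hf] with ν h using (h s hs).2
  have hf'int : Integrable f' (volume.restrict (Set.Ioc a b)) :=
    Integrable.of_bound hmeas C hbd
  obtain ⟨-, key⟩ := hasFDerivAt_integral_of_dominated_loc_of_lip' (𝕜 := ℝ)
    (F := fun ν s => f s ν) (F' := L ∘ f') (bound := fun _ => C) (x₀ := ν0)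
    (hfInt.and hf) (fun x hx => hx.1.aestronglyMeasurable) hfInt.self_of_nhds hm
    (by filter_upwards [hmem] with s hs ν hν using (hν.2 s hs).2)
    (integrable_const _)
    (by filter_upwards [hmem] with s hs using (hd s hs).hasFDerivAt)
  refine ⟨(intervalIntegrable_iff_integrableOn_Ioc_of_le hab).2 hf'int, ?_⟩
  simp only [intervalIntegral.integral_of_le hab]
  have := L.integral_comp_comm hf'int
  simp only [Function.comp_def] at key
  rw [this] at key
  simpa [L] using key.hasDerivAt

theorem cor23_prim_cont {g φ : ℝ → ℝ}
    (h : ∀ a b, 0 < a → a ≤ b → IntervalIntegrable φ volume a b ∧ g b - g a = ∫ s in a..b, φ s) :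
    ContinuousOn g (Set.Ioi 0) := by
  intro t ht
  have ht : 0 < t := ht
  apply ContinuousAt.continuousWithinAt
  have h1 := intervalIntegral.continuousOn_primitive_interval'
    (h (t/2) (2*t) (by linarith) (by linarith)).1 (a := t/2) Set.left_mem_uIcc
  rw [Set.uIcc_of_le (by linarith)] at h1
  have h2 := h1.continuousAt (Icc_mem_nhds (by linarith) (by linarith) : _ ∈ 𝓝 t)
  refine (h2.add_const (g (t/2))).congr ?_
  filter_upwards [Ioi_mem_nhds (by linarith : t/2 < t)] with x hx
  rw [← (h (t/2) x (by linarith) (le_of_lt hx)).2]; ring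

theorem cor23_prim_deriv {g φ : ℝ → ℝ}
    (h : ∀ a b, 0 < a → a ≤ b → IntervalIntegrable φ volume a b ∧ g b - g a = ∫ s in a..b, φ s)
    (hφ : ContinuousOn φ (Set.Ioi 0)) {t : ℝ} (ht : 0 < t) : HasDerivAt g (φ t) t := by
  have h2 := intervalIntegral.integral_hasDerivAt_right
    (h (t/2) t (by linarith) (by linarith)).1
    (hφ.stronglyMeasurableAtFilter isOpen_Ioi t ht)
    (hφ.continuousAt (Ioi_mem_nhds ht))
  refine (h2.add_const (g (t/2))).congr_of_eventuallyEq ?_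
  filter_upwards [Ioi_mem_nhds (by linarith : t/2 < t)] with x hx
  rw [← (h (t/2) x (by linarith) (le_of_lt hx)).2]; ring

theorem cor23_good {ν0 a b : ℝ} {I : Set ℝ} (hI : I ∈ 𝓝 ν0) (q p : ℝ → ℝ → ℝ)
    (ha : 0 < a) (hab : a ≤ b)
    (hq : ∀ ν ∈ I, ∀ t > (0:ℝ), HasDerivAt (fun t' => q t' ν) (-(p t ν) / t) t)
    (hp : ∀ ν ∈ I, ∀ t > (0:ℝ), HasDerivAt (fun t' => p t' ν)
      (-(t/2) * Real.sinh (2 * q t ν) - 2 * ν * Real.sinh (q t ν)) t)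
    (hqnu : ∀ t > (0:ℝ), DifferentiableAt ℝ (fun ν' => q t ν') ν0)
    (hpnu : ∀ t > (0:ℝ), DifferentiableAt ℝ (fun ν' => p t ν') ν0) :
    Cor23Good q a b ν0 ∧ Cor23Good p a b ν0 := by
  have hν0 : ν0 ∈ I := mem_of_mem_nhds hI
  have hb : 0 < b := by linarith
  have hpos : ∀ s ∈ Set.Icc a b, 0 < s := fun s hs => ha.trans_le hs.1
  have bnd : ∀ f : ℝ → ℝ, DifferentiableAt ℝ f ν0 → ∀ᶠ ν in 𝓝 ν0, |f ν| ≤ |f ν0| + 1 := by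
    intro f hf
    have := hf.continuousAt.abs.eventually (gt_mem_nhds (lt_add_one (|f ν0|)))
    filter_upwards [this] with ν h using h.le
  have lip : ∀ f : ℝ → ℝ, DifferentiableAt ℝ f ν0 →
      ∃ C, 0 ≤ C ∧ ∀ᶠ ν in 𝓝 ν0, |f ν - f ν0| ≤ C * |ν - ν0| := by
    intro f hf
    obtain ⟨C, hC, h⟩ := hf.isBigO_sub.exists_pos
    exact ⟨C, hC.le, h.bound⟩
  obtain ⟨C1, hC1, h1⟩ := lip _ (hqnu a ha)
  obtain ⟨C2, hC2, h2⟩ := lip _ (hpnu a ha)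
  have ba := bnd _ (hqnu a ha)
  have bb := bnd _ (hqnu b hb)
  have bn := bnd _ (differentiableAt_id (𝕜 := ℝ) (x := ν0))
  simp only [id] at bn
  set M := |q a ν0| + |q b ν0| + 1 + 2 * (|ν0| + 1) / a with hM
  have hM0 : 0 ≤ M := by positivity
  have hdiv : 0 ≤ 2 * (|ν0| + 1) / a := by positivity
  have haM : 2 * (|ν0| + 1) ≤ a * M := by
    have : a * M = a * (|q a ν0| + |q b ν0| + 1) + 2 * (|ν0| + 1) := by
      rw [hM]; field_simp
    have : 0 ≤ a * (|q a ν0| + |q b ν0| + 1) := by positivity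
    linarith
  have na := abs_nonneg (q a ν0)
  have nb := abs_nonneg (q b ν0)
  have hbound : ∀ᶠ ν in 𝓝 ν0, ∀ s ∈ Set.Icc a b, |q s ν| ≤ M := by
    filter_upwards [hI, ba, bb, bn] with ν hν ba bb bn
    exact cor23_abs ha hab (fun s => q s ν) (fun s => p s ν)
      (fun s hs => hq ν hν s (hpos s hs)) (fun s hs => hp ν hν s (hpos s hs)) hM0
      (by linarith) (by linarith) (by linarith)
  obtain ⟨C, key⟩ : ∃ C : ℝ, ∀ᶠ ν in 𝓝 ν0, ∀ s ∈ Set.Icc a b,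
      |q s ν - q s ν0| ≤ C * |ν - ν0| ∧ |p s ν - p s ν0| ≤ C * |ν - ν0| := by
    refine ⟨(C1 + C2 + 2 * Real.cosh M /
      (1/a + b * Real.cosh (2*M) + 2 * (|ν0| + 1) * Real.cosh M)) *
      Real.exp ((1/a + b * Real.cosh (2*M) + 2 * (|ν0| + 1) * Real.cosh M) * (b - a)), ?_⟩
    filter_upwards [hI, hbound, bn, h1, h2] with ν hν hb bn h1 h2
    exact cor23_gronwall (C0 := C1 + C2) ha hab (fun s => q s ν) (fun s => p s ν)
      (fun s => q s ν0) (fun s => p s ν0)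
      (fun s hs => hq ν hν s (hpos s hs)) (fun s hs => hp ν hν s (hpos s hs))
      (fun s hs => hq ν0 hν0 s (hpos s hs)) (fun s hs => hp ν0 hν0 s (hpos s hs))
      hb hbound.self_of_nhds bn (by positivity)
      (h1.trans (by gcongr; linarith)) (h2.trans (by gcongr; linarith))
  constructor
  · refine .mk' ?_ (key.mono fun ν h s hs => (h s hs).1)
    filter_upwards [hI] with ν hν s hs
    exact (hq ν hν s (hpos s hs)).continuousAt.continuousWithinAt
  · refine .mk' ?_ (key.mono fun ν h s hs => (h s hs).2)
    filter_upwards [hI] with ν hν s hs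
    exact (hp ν hν s (hpos s hs)).continuousAt.continuousWithinAt

theorem stmt3 (lam : ℝ) (I : Set ℝ) (hI : ∃ a b : ℝ, I = Set.Ioo a b)
    (q p qt qnu : ℝ → ℝ → ℝ)
    -- (i) Hamiltonian system in t, for each ν ∈ I
    (hqt : ∀ ν ∈ I, ∀ t > (0:ℝ), HasDerivAt (fun t' => q t' ν) (qt t ν) t)
    (hqt' : ∀ ν ∈ I, ∀ t > (0:ℝ), qt t ν = -(p t ν) / t)
    (hp : ∀ ν ∈ I, ∀ t > (0:ℝ), HasDerivAt (fun t' => p t' ν)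
      (-(t/2) * Real.sinh (2 * q t ν) - 2 * ν * Real.sinh (q t ν)) t)
    -- (ii) differentiability in ν and equality of mixed partials of q
    (hqnu : ∀ t > (0:ℝ), ∀ ν ∈ I, HasDerivAt (fun ν' => q t ν') (qnu t ν) ν)
    (hpnu : ∀ t > (0:ℝ), ∀ ν ∈ I, DifferentiableAt ℝ (fun ν' => p t ν') ν)
    (hmix : ∀ t > (0:ℝ), ∀ ν ∈ I,
      HasDerivAt (fun ν' => qt t ν') (deriv (fun t' => qnu t' ν) t) ν)
    -- (iii) absolute convergence of the action integral and differentiation under it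
    (hSint : ∀ t > (0:ℝ), ∀ ν ∈ I,
      MeasureTheory.IntegrableOn (fun s => p s ν * qt s ν - Ham2 q p s ν) (Set.Ioi t))
    (hleib : ∀ t > (0:ℝ), ∀ ν ∈ I,
      HasDerivAt (fun ν' => ∫ s in Set.Ioi t, (p s ν' * qt s ν' - Ham2 q p s ν'))
        (∫ s in Set.Ioi t, deriv (fun ν' => p s ν' * qt s ν' - Ham2 q p s ν') ν) ν)
    -- (iv) decay of p·∂q/∂ν at t = +∞
    (hdecay : ∀ ν ∈ I, Filter.Tendsto (fun s => p s ν * qnu s ν) Filter.atTop (nhds 0))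
    -- (v) integrability of sinh²(q/2)
    (hsint : ∀ t > (0:ℝ), ∀ ν ∈ I,
      MeasureTheory.IntegrableOn (fun s => Real.sinh (q s ν / 2) ^ 2) (Set.Ioi t)) :
    ∀ t > (0:ℝ), ∀ ν ∈ I,
      (∫ s in Set.Ioi t, Real.sinh (q s ν / 2) ^ 2)
        = -(1/4) * (p t ν * qnu t ν
          + deriv (fun ν' => ∫ s in Set.Ioi t, (p s ν' * qt s ν' - Ham2 q p s ν')) ν) := by
  intro t ht ν hν
  have hInh : I ∈ 𝓝 ν := by
    obtain ⟨a, b, rfl⟩ := hI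
    exact Ioo_mem_nhds hν.1 hν.2
  have hq1 : ∀ ν ∈ I, ∀ t > (0:ℝ), HasDerivAt (fun t' => q t' ν) (-(p t ν) / t) t :=
    fun ν hν t ht => (hqt ν hν t ht).congr_deriv (hqt' ν hν t ht)
  have hgood := fun a b (ha : 0 < a) (hab : a ≤ b) => cor23_good hInh q p ha hab hq1 hp
    (fun t ht => (hqnu t ht ν hν).differentiableAt) (fun t ht => hpnu t ht ν hν)
  obtain ⟨pnu, hpn⟩ : ∃ pnu : ℝ → ℝ, ∀ s > 0, HasDerivAt (fun ν' => p s ν') (pnu s) ν :=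
    ⟨fun s => deriv (fun ν' => p s ν') ν, fun s hs => (hpnu s hs ν hν).hasDerivAt⟩
  have hqn : ∀ s > 0, HasDerivAt (fun ν' => q s ν') (qnu s ν) ν := fun s hs => hqnu s hs ν hν
  have hqc : ContinuousOn (fun s => q s ν) (Set.Ioi 0) := fun s hs =>
    (hq1 ν hν s hs).continuousAt.continuousWithinAt
  have hpc : ContinuousOn (fun s => p s ν) (Set.Ioi 0) := fun s hs =>
    (hp ν hν s hs).continuousAt.continuousWithinAt
  have hinv : ContinuousOn (fun s : ℝ => -1 / s) (Set.Ioi 0) :=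
    continuousOn_const.div continuousOn_id (fun s hs => ne_of_gt hs)
  have hsub : ∀ {a b : ℝ}, 0 < a → Set.Icc a b ⊆ Set.Ioi 0 := fun ha s hs => ha.trans_le hs.1
  -- the function q_ν as a primitive
  have Q : ∀ a b, 0 < a → a ≤ b →
      IntervalIntegrable (fun s => -1 / s * pnu s) volume a b ∧
      (fun s => qnu s ν) b - (fun s => qnu s ν) a = ∫ s in a..b, -1 / s * pnu s := by
    intro a b ha hab
    have hg : Cor23Good (fun s ν => -1 / s * p s ν) a b ν :=
      (Cor23Good.indep (hinv.mono (hsub ha))).mul (hgood a b ha hab).2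
    obtain ⟨h1, h2⟩ := hg.leibniz hab (fun s => -1 / s * pnu s)
      (fun s hs => (hpn s (hsub ha hs)).const_mul _)
    refine ⟨h1, HasDerivAt.unique ?_ h2⟩
    refine ((hqn b (ha.trans_le hab)).sub (hqn a ha)).congr_of_eventuallyEq ?_
    filter_upwards [hInh, hg.1] with ν' hν' hc
    refine intervalIntegral.integral_eq_sub_of_hasDerivAt (f := fun s => q s ν') ?_ ?_
    · intro s hs
      rw [Set.uIcc_of_le hab] at hs
      exact (hq1 ν' hν' s (hsub ha hs)).congr_deriv (by ring)
    · exact ContinuousOn.intervalIntegrable_of_Icc hab hc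
  have hqnuc : ContinuousOn (fun s => qnu s ν) (Set.Ioi 0) := cor23_prim_cont Q
  have P : ∀ a b, 0 < a → a ≤ b →
      IntervalIntegrable (fun s => -(s/2) * (Real.cosh (2 * q s ν) * (2 * qnu s ν)) +
        ((-2) * Real.sinh (q s ν) + (-2 * ν) * (Real.cosh (q s ν) * qnu s ν))) volume a b ∧
      pnu b - pnu a = ∫ s in a..b, (-(s/2) * (Real.cosh (2 * q s ν) * (2 * qnu s ν)) +
        ((-2) * Real.sinh (q s ν) + (-2 * ν) * (Real.cosh (q s ν) * qnu s ν))) := by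
    intro a b ha hab
    have hgq := (hgood a b ha hab).1
    have c2 : Cor23Good (fun _ _ => 2) a b ν := .indep continuousOn_const
    have cm2 : Cor23Good (fun _ _ => -2) a b ν := .indep continuousOn_const
    have cs : Cor23Good (fun s _ => -(s/2)) a b ν := .indep (by fun_prop)
    have hg : Cor23Good (fun s ν => -(s/2) * Real.sinh (2 * q s ν) +
        (-2 * ν) * Real.sinh (q s ν)) a b ν :=
      (cs.mul (c2.mul hgq).sinh).add ((cm2.mul .param).mul hgq.sinh)
    obtain ⟨h1, h2⟩ := hg.leibniz hab (fun s => -(s/2) * (Real.cosh (2 * q s ν) * (2 * qnu s ν)) +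
        ((-2) * Real.sinh (q s ν) + (-2 * ν) * (Real.cosh (q s ν) * qnu s ν)))
      (fun s hs => by
        have hd := hqn s (hsub ha hs)
        have d1 := ((hd.const_mul 2).sinh).const_mul (-(s/2))
        have d2 := ((hasDerivAt_id ν).const_mul (-2)).mul hd.sinh
        exact (d1.add d2).congr_deriv (by simp))
    refine ⟨h1, HasDerivAt.unique ?_ h2⟩
    refine ((hpn b (ha.trans_le hab)).sub (hpn a ha)).congr_of_eventuallyEq ?_
    filter_upwards [hInh, hg.1] with ν' hν' hc
    refine intervalIntegral.integral_eq_sub_of_hasDerivAt (f := fun s => p s ν') ?_ ?_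
    · intro s hs
      rw [Set.uIcc_of_le hab] at hs
      exact (hp ν' hν' s (hsub ha hs)).congr_deriv (by ring)
    · exact ContinuousOn.intervalIntegrable_of_Icc hab hc
  have hpnuc : ContinuousOn pnu (Set.Ioi 0) := cor23_prim_cont P
  have hqnud : ∀ s > 0, HasDerivAt (fun s => qnu s ν) (-1 / s * pnu s) s :=
    fun s hs => cor23_prim_deriv Q (hinv.mul hpnuc) hs
  -- derivative of p * q_ν in t
  obtain ⟨W, hW⟩ : ∃ W : ℝ → ℝ, W = fun s =>
    (-(s/2) * Real.sinh (2 * q s ν) - 2 * ν * Real.sinh (q s ν)) * qnu s ν +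
      p s ν * (-1 / s * pnu s) := ⟨_, rfl⟩
  have hWd : ∀ s > 0, HasDerivAt (fun s => p s ν * qnu s ν) (W s) s := by
    intro s hs
    rw [hW]
    exact (hp ν hν s hs).mul (hqnud s hs)
  obtain ⟨G, hG⟩ : ∃ G : ℝ → ℝ, G = fun s => W s - 4 * Real.sinh (q s ν / 2) ^ 2 := ⟨_, rfl⟩
  have hWc : ContinuousOn W (Set.Ioi 0) := by
    rw [hW]
    have h1 : ContinuousOn (fun s => Real.sinh (2 * q s ν)) (Set.Ioi 0) :=
      Real.continuous_sinh.comp_continuousOn (continuousOn_const.mul hqc)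
    have h2 : ContinuousOn (fun s => Real.sinh (q s ν)) (Set.Ioi 0) :=
      Real.continuous_sinh.comp_continuousOn hqc
    have h3 : ContinuousOn (fun s : ℝ => -(s/2)) (Set.Ioi 0) := by fun_prop
    exact (((h3.mul h1).sub (continuousOn_const.mul h2)).mul hqnuc).add
      (hpc.mul (hinv.mul hpnuc))
  have hGc : ContinuousOn G (Set.Ioi 0) := by
    rw [hG]
    have h2 : ContinuousOn (fun s => Real.sinh (q s ν / 2)) (Set.Ioi 0) :=
      Real.continuous_sinh.comp_continuousOn (hqc.div_const 2)
    exact hWc.sub (continuousOn_const.mul (h2.pow 2))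
  -- the Lagrangian
  have hLag : ∀ ν' ∈ I, ∀ s > 0, p s ν' * qt s ν' - Ham2 q p s ν' =
      (-1 / s * (1/2)) * (p s ν' * p s ν') + (-(s/2) * (Real.sinh (q s ν') * Real.sinh (q s ν')) +
        (-4 * ν') * (Real.sinh (1/2 * q s ν') * Real.sinh (1/2 * q s ν'))) := by
    intro ν' hν' s hs
    rw [hqt' ν' hν' s hs, Ham2, show q s ν' / 2 = 1/2 * q s ν' by ring]
    field_simp
    ring
  have hLd : ∀ s > 0, HasDerivAt (fun ν' => (-1 / s * (1/2)) * (p s ν' * p s ν') +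
      (-(s/2) * (Real.sinh (q s ν') * Real.sinh (q s ν')) +
        (-4 * ν') * (Real.sinh (1/2 * q s ν') * Real.sinh (1/2 * q s ν')))) (G s) ν := by
    intro s hs
    have hd := hqn s hs
    have hh := (hd.const_mul (1/2)).sinh
    have d1 := ((hpn s hs).mul (hpn s hs)).const_mul (-1 / s * (1/2))
    have d2 := (hd.sinh.mul hd.sinh).const_mul (-(s/2))
    have d3 := ((hasDerivAt_id ν).const_mul (-4)).mul (hh.mul hh)
    refine (d1.add (d2.add d3)).congr_deriv ?_
    have e1 : Real.sinh (2 * q s ν) = 2 * Real.sinh (q s ν) * Real.cosh (q s ν) :=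
      Real.sinh_two_mul _
    have e2 : Real.sinh (q s ν) = 2 * Real.sinh (1/2 * q s ν) * Real.cosh (1/2 * q s ν) := by
      rw [← Real.sinh_two_mul]; congr 1; ring
    have e3 : 2 * ν * Real.sinh (q s ν) =
      2 * ν * (2 * Real.sinh (1/2 * q s ν) * Real.cosh (1/2 * q s ν)) := by rw [e2]
    rw [hG, hW]
    simp only [id, Pi.mul_apply]
    rw [show q s ν / 2 = 1/2 * q s ν by ring, e3, e1]
    ring
  have hGder : ∀ s > 0, deriv (fun ν' => p s ν' * qt s ν' - Ham2 q p s ν') ν = G s := by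
    intro s hs
    refine ((hLd s hs).congr_of_eventuallyEq ?_).deriv
    filter_upwards [hInh] with ν' hν' using hLag ν' hν' s hs
  have hS : ∀ r > 0, HasDerivAt
      (fun ν' => ∫ s in Set.Ioi r, (p s ν' * qt s ν' - Ham2 q p s ν'))
        (∫ s in Set.Ioi r, G s) ν := by
    intro r hr
    refine (hleib r hr ν hν).congr_deriv ?_
    exact setIntegral_congr_fun measurableSet_Ioi (fun s hs => hGder s (hr.trans hs))
  have hGint : IntegrableOn G (Set.Ioi t) := by
    by_contra hcon
    have hn : ∀ r ≥ t, ¬ IntegrableOn G (Set.Ioi r) := by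
      intro r hr h
      apply hcon
      rw [← Set.Ioc_union_Ioi_eq_Ioi hr]
      refine IntegrableOn.union ?_ h
      exact ((hGc.mono (hsub ht)).integrableOn_Icc).mono_set Set.Ioc_subset_Icc_self
    have hz : ∀ r ≥ t, ∫ s in t..r, G s = 0 := by
      intro r hr
      have hgq := (hgood t r ht hr).1
      have hgp := (hgood t r ht hr).2
      have ch : Cor23Good (fun _ _ => 1/2) t r ν := .indep continuousOn_const
      have cm : Cor23Good (fun _ _ => -4) t r ν := .indep continuousOn_const
      have cs : Cor23Good (fun s _ => -(s/2)) t r ν := .indep (by fun_prop)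
      have ci : Cor23Good (fun s _ => -1/s * (1/2)) t r ν :=
        .indep ((hinv.mono (hsub ht)).mul continuousOn_const)
      have hg := (ci.mul (hgp.mul hgp)).add ((cs.mul (hgq.sinh.mul hgq.sinh)).add
        ((cm.mul .param).mul ((ch.mul hgq).sinh.mul (ch.mul hgq).sinh)))
      obtain ⟨-, h2⟩ := hg.leibniz hr G (fun s hs => hLd s (hsub ht hs))
      have h3 := (hS t ht).sub (hS r (ht.trans_le hr))
      rw [integral_undef (hn t le_rfl), integral_undef (hn r hr), sub_zero] at h3
      refine h2.unique (h3.congr_of_eventuallyEq ?_)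
      filter_upwards [hInh] with ν' hν'
      have h4 := intervalIntegral.integral_Ioi_sub_Ioi (hSint t ht ν' hν') hr
      simp only [Pi.sub_apply]
      rw [h4]
      refine intervalIntegral.integral_congr fun s hs => ?_
      rw [Set.uIcc_of_le hr] at hs
      exact (hLag ν' hν' s (hsub ht hs)).symm
    have hG0 : ∀ x ∈ Set.Ioi t, G x = 0 := by
      intro x hx
      have hx : t < x := hx
      have hx0 : 0 < x := ht.trans hx
      have h2 := intervalIntegral.integral_hasDerivAt_right
        (ContinuousOn.intervalIntegrable_of_Icc hx.le (hGc.mono (hsub ht)))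
        (hGc.stronglyMeasurableAtFilter isOpen_Ioi x hx0)
        (hGc.continuousAt (Ioi_mem_nhds hx0))
      refine h2.unique ((hasDerivAt_const x (0:ℝ)).congr_of_eventuallyEq ?_)
      filter_upwards [Ioi_mem_nhds hx] with y hy using hz y (le_of_lt hy)
    exact hcon (integrableOn_zero.congr_fun (fun x hx => (hG0 x hx).symm) measurableSet_Ioi)
  have hs4 := (hsint t ht ν hν).const_mul 4
  have hWint : IntegrableOn W (Set.Ioi t) := by
    refine (hGint.add hs4).congr_fun (fun s _ => ?_) measurableSet_Ioi
    simp [hG]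
  have hfin := integral_Ioi_of_hasDerivAt_of_tendsto'
    (fun s (hs : s ∈ Set.Ici t) => hWd s (ht.trans_le hs)) hWint (hdecay ν hν)
  have hsplit : ∫ s in Set.Ioi t, G s = (∫ s in Set.Ioi t, W s) -
      4 * ∫ s in Set.Ioi t, Real.sinh (q s ν / 2) ^ 2 := by
    rw [hG, ← integral_const_mul]
    exact integral_sub hWint hs4
  rw [(hS t ht).deriv, hsplit, hfin]
  ring
end

section
/- Let λ ∈ (0, 1/π), ν > −1/2, and suppose σ(λ) < 1 + 2ν. Write σ = σ(λ) and s = s(λ), and define J₊(ν,λ) := ∫₀^λ σ(λ')·(d/dλ')[ln Γ(ν + (1+σ(λ'))/2)] dλ' and J₋(ν,λ) := ∫₀^λ σ(λ')·(d/dλ')[ln Γ(ν + (1−σ(λ'))/2)] dλ'. Then J₊(ν,λ) − J₋(ν,λ) = σ²/2 + 2·[F(ν−s) + F(ν+s) − 2·F(ν−1/2)] + (1−2ν)·ln[Γ(1−s+ν)·Γ(1+s+ν)/Γ(1/2+ν)²] − 2·ln Γ(1+s+ν) + (1+2ν)·ln(s+ν). -/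
/- STATEMENT 5 (Proposition 3.1): closed-form evaluation of J₊ − J₋. -/

/-- `σ(λ) = (2/π)·arcsin(πλ)`. -/
noncomputable def sig (l : ℝ) : ℝ := 2 / Real.pi * Real.arcsin (Real.pi * l)

/-- `s(λ) = (1 − σ(λ))/2`. -/
noncomputable def sfun (l : ℝ) : ℝ := (1 - sig l) / 2

/-- `J₊(ν,λ) = ∫₀^λ σ(λ')·(d/dλ')[ln Γ(ν + (1+σ(λ'))/2)] dλ'`. -/
noncomputable def Jp (ν l : ℝ) : ℝ :=
  ∫ l' in (0:ℝ)..l, sig l' * deriv (fun x => Real.log (Real.Gamma (ν + (1 + sig x) / 2))) l'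

/-- `J₋(ν,λ) = ∫₀^λ σ(λ')·(d/dλ')[ln Γ(ν + (1−σ(λ'))/2)] dλ'`. -/
noncomputable def Jm (ν l : ℝ) : ℝ :=
  ∫ l' in (0:ℝ)..l, sig l' * deriv (fun x => Real.log (Real.Gamma (ν + (1 - sig x) / 2))) l'

noncomputable def LG (x : ℝ) : ℝ := Real.log (Real.Gamma x)

noncomputable def MG (w : ℝ) : ℝ := ∫ x in (1:ℝ)..w, LG x

lemma contDiffAt_LG {x : ℝ} (hx : 0 < x) : ContDiffAt ℝ 1 LG x := by
  have h1 : ContDiffAt ℂ 1 Complex.Gamma (x : ℂ) := by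
    have hd : DifferentiableOn ℂ Complex.Gamma {z : ℂ | 0 < z.re} := by
      intro z hz
      refine (Complex.differentiableAt_Gamma z ?_).differentiableWithinAt
      intro m h
      have hz' : 0 < z.re := hz
      rw [h] at hz'
      simp at hz'
      have : (0:ℝ) ≤ m := Nat.cast_nonneg m
      linarith
    have ho : IsOpen {z : ℂ | 0 < z.re} := isOpen_lt continuous_const Complex.continuous_re
    exact (hd.analyticAt (ho.mem_nhds (by simpa using hx))).contDiffAt
  have h2 : ContDiffAt ℝ 1 Real.Gamma x := h1.real_of_complex
  exact h2.log (Real.Gamma_pos_of_pos hx).ne'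

lemma continuousOn_LG : ContinuousOn LG (Set.Ioi 0) := fun _ hx =>
  (contDiffAt_LG hx).continuousAt.continuousWithinAt

lemma uIcc_sub_Ioi {a b : ℝ} (ha : 0 < a) (hb : 0 < b) : Set.uIcc a b ⊆ Set.Ioi 0 := by
  intro x hx
  exact lt_of_lt_of_le (lt_min ha hb) hx.1

lemma LG_int {a b : ℝ} (ha : 0 < a) (hb : 0 < b) :
    IntervalIntegrable LG MeasureTheory.volume a b :=
  (continuousOn_LG.mono (uIcc_sub_Ioi ha hb)).intervalIntegrable

lemma hasDerivAt_MG {w : ℝ} (hw : 0 < w) : HasDerivAt MG (LG w) w := by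
  refine intervalIntegral.integral_hasDerivAt_right (LG_int one_pos hw) ?_
    (contDiffAt_LG hw).continuousAt
  exact continuousOn_LG.stronglyMeasurableAtFilter isOpen_Ioi w hw

lemma const_of_deriv {f : ℝ → ℝ} (hf : ∀ x, 0 < x → HasDerivAt f 0 x) {x y : ℝ}
    (hx : 0 < x) (hy : 0 < y) : f x = f y := by
  refine isOpen_Ioi.is_const_of_deriv_eq_zero (s := Set.Ioi (0:ℝ)) isPreconnected_Ioi
    (fun z hz => (hf z hz).differentiableAt.differentiableWithinAt)
    (fun z hz => (hf z hz).deriv) hx hy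

lemma LG_add_one {q : ℝ} (hq : 0 < q) : LG (q + 1) = Real.log q + LG q := by
  unfold LG
  rw [Real.Gamma_add_one hq.ne', Real.log_mul hq.ne' (Real.Gamma_pos_of_pos hq).ne']

lemma LG_dup {s : ℝ} (hs : 0 < s) :
    LG s + LG (s + 1/2) = LG (2 * s) + (1 - 2 * s) * Real.log 2 + 1/2 * Real.log Real.pi := by
  unfold LG
  have h2 : (0:ℝ) < 2 ^ (1 - 2 * s) := Real.rpow_pos_of_pos two_pos _
  have h3 := Real.Gamma_pos_of_pos (by linarith : 0 < 2 * s)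
  rw [← Real.log_mul (Real.Gamma_pos_of_pos hs).ne'
    (Real.Gamma_pos_of_pos (by linarith : 0 < s + 1/2)).ne', Real.Gamma_mul_Gamma_add_half,
    Real.log_mul (by positivity) (by positivity), Real.log_mul (by positivity) (by positivity),
    Real.log_rpow two_pos, Real.log_sqrt Real.pi_pos.le]
  ring

lemma raabe_diff {q : ℝ} (hq : 0 < q) :
    MG (q + 1) - MG q - (q * Real.log q - q) = MG 2 - MG 1 + 1 := by
  have h := const_of_deriv (f := fun q => MG (q + 1) - MG q - (q * Real.log q - q)) ?_ hq one_pos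
  · rw [h]; norm_num
  · intro x hx
    have h1 : HasDerivAt (fun q => MG (q + 1)) (LG (x + 1)) x :=
      (hasDerivAt_MG (by linarith : 0 < x + 1)).comp_add_const x 1
    have h2 := (Real.hasDerivAt_mul_log hx.ne').sub (hasDerivAt_id x)
    have h3 := (h1.sub (hasDerivAt_MG hx)).sub h2
    refine h3.congr_deriv ?_
    rw [LG_add_one hx]; ring

lemma raabe {q : ℝ} (hq : 0 < q) :
    MG (q + 1) - MG q = q * Real.log q - q + 1/2 * Real.log (2 * Real.pi) := by
  have h := const_of_deriv (f := fun s => MG s + MG (s + 1/2) - MG (2 * s) / 2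
    - (s - s^2) * Real.log 2 - s * (1/2 * Real.log Real.pi)) ?_ one_pos
    (by norm_num : (0:ℝ) < 1/2)
  · have e1 := raabe_diff hq
    have e2 := raabe_diff (q := 1/2) (by norm_num)
    have e3 : Real.log (1/2) = - Real.log 2 := by rw [one_div, Real.log_inv]
    rw [e3] at e2
    rw [Real.log_mul two_ne_zero Real.pi_pos.ne']
    norm_num at h e2
    linarith
  · intro x hx
    have h1 : HasDerivAt (fun q => MG (q + 1/2)) (LG (x + 1/2)) x :=
      (hasDerivAt_MG (by linarith : 0 < x + 1/2)).comp_add_const x (1/2)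
    have h2 : HasDerivAt (fun q => MG (2 * q)) (LG (2 * x) * (2 * 1)) x :=
      HasDerivAt.comp (h₂ := MG) x (hasDerivAt_MG (by linarith : 0 < 2 * x))
        ((hasDerivAt_id x).const_mul 2)
    have h3 := ((((hasDerivAt_MG hx).add h1).sub (h2.div_const 2)).sub
      (((hasDerivAt_id x).sub (hasDerivAt_pow 2 x)).mul_const (Real.log 2))).sub
      ((hasDerivAt_id x).mul_const (1/2 * Real.log Real.pi))
    refine h3.congr_deriv ?_
    have := LG_dup hx
    push_cast
    linear_combination this

lemma FG_eq (z : ℝ) : FG z = z / 2 * Real.log (2 * Real.pi) - z * (z + 1) / 2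
    + z * LG (1 + z) - MG (1 + z) := by
  unfold FG MG
  have : (∫ x in (0:ℝ)..z, Real.log (Real.Gamma (1 + x))) = ∫ x in (1:ℝ)..(1 + z), LG x := by
    have := intervalIntegral.integral_comp_add_left (a := 0) (b := z) LG 1
    simpa [LG] using this
  rw [this]; rfl

lemma contDiffAt_sig {l : ℝ} (h0 : 0 ≤ l) (h1 : l < 1 / Real.pi) : ContDiffAt ℝ 1 sig l := by
  have hp := Real.pi_pos
  have h2 : Real.pi * l < 1 := by
    rw [lt_div_iff₀ hp] at h1; linarith
  have h3 : 0 ≤ Real.pi * l := by positivity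
  have h4 : ContDiffAt ℝ 1 Real.arcsin (Real.pi * l) :=
    Real.contDiffAt_arcsin (by linarith) (by linarith)
  have h5 : ContDiffAt ℝ 1 (fun l => Real.pi * l) l := contDiffAt_const.mul contDiffAt_id
  exact contDiffAt_const.mul (ContDiffAt.comp (g := Real.arcsin) l h4 h5)

lemma sig_mono {x y : ℝ} (h : x ≤ y) : sig x ≤ sig y := by
  unfold sig
  have hp := Real.pi_pos
  have := Real.monotone_arcsin (mul_le_mul_of_nonneg_left h hp.le)
  gcongr

lemma sig_zero : sig 0 = 0 := by simp [sig]

lemma J_gen (lam ν ε : ℝ) (hε : ε * ε = 1) (hlam : lam ∈ Set.Ioo (0:ℝ) (1 / Real.pi))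
    (hpos : ∀ x ∈ Set.Icc 0 lam, 0 < ν + (1 + ε * sig x) / 2) :
    ∫ l' in (0:ℝ)..lam, sig l' * deriv (fun x => LG (ν + (1 + ε * sig x) / 2)) l'
      = sig lam * LG (ν + (1 + ε * sig lam) / 2)
        - 2 * ε * (MG (ν + (1 + ε * sig lam) / 2) - MG (ν + 1 / 2)) := by
  have hI : Set.uIcc 0 lam = Set.Icc 0 lam := Set.uIcc_of_le hlam.1.le
  have hs : ∀ x ∈ Set.Icc 0 lam, ContDiffAt ℝ 1 sig x := fun x hx =>
    contDiffAt_sig hx.1 (lt_of_le_of_lt hx.2 hlam.2)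
  have hin : ∀ x ∈ Set.Icc 0 lam, ContDiffAt ℝ 1 (fun x => ν + (1 + ε * sig x) / 2) x :=
    fun x hx => contDiffAt_const.add ((contDiffAt_const.add
      (contDiffAt_const.mul (hs x hx))).div_const 2)
  have hf : ∀ x ∈ Set.Icc 0 lam, ContDiffAt ℝ 1 (fun x => LG (ν + (1 + ε * sig x) / 2)) x :=
    fun x hx => ContDiffAt.comp (g := LG) x (contDiffAt_LG (hpos x hx)) (hin x hx)
  have key := intervalIntegral.integral_eq_sub_of_hasDerivAt (a := 0) (b := lam)
    (f := fun x => sig x * LG (ν + (1 + ε * sig x) / 2) - 2 * ε * MG (ν + (1 + ε * sig x) / 2))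
    (f' := fun l' => sig l' * deriv (fun x => LG (ν + (1 + ε * sig x) / 2)) l') ?_ ?_
  · rw [key]
    simp only [sig_zero]
    ring_nf
  · intro x hx
    rw [hI] at hx
    have d1 := ((hs x hx).differentiableAt one_ne_zero).hasDerivAt
    have d2 := ((hf x hx).differentiableAt one_ne_zero).hasDerivAt
    have d3 : HasDerivAt (fun x => ν + (1 + ε * sig x) / 2) (ε * deriv sig x / 2) x :=
      (((d1.const_mul ε).const_add 1).div_const 2).const_add ν
    have d4 := HasDerivAt.comp (h₂ := MG) x (hasDerivAt_MG (hpos x hx)) d3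
    have d5 := (d1.mul d2).sub (d4.const_mul (2 * ε))
    refine d5.congr_deriv ?_
    linear_combination -(LG (ν + (1 + ε * sig x) / 2) * deriv sig x) * hε
  · apply ContinuousOn.intervalIntegrable
    rw [hI]
    intro x hx
    refine ContinuousAt.continuousWithinAt ((hs x hx).continuousAt.mul ?_)
    exact ContDiffAt.continuousAt (n := 0) ((hf x hx).derivWithin (m := 0) (by norm_num))

theorem stmt5 (lam ν : ℝ) (hlam : lam ∈ Set.Ioo (0:ℝ) (1 / Real.pi))
    (hν : -(1/2 : ℝ) < ν) (hσν : sig lam < 1 + 2 * ν) :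
    Jp ν lam - Jm ν lam
      = (sig lam) ^ 2 / 2
        + 2 * (FG (ν - sfun lam) + FG (ν + sfun lam) - 2 * FG (ν - 1/2))
        + (1 - 2*ν) * Real.log (Real.Gamma (1 - sfun lam + ν) * Real.Gamma (1 + sfun lam + ν)
            / Real.Gamma (1/2 + ν) ^ 2)
        - 2 * Real.log (Real.Gamma (1 + sfun lam + ν))
        + (1 + 2*ν) * Real.log (sfun lam + ν) := by
  have hs0 : ∀ x ∈ Set.Icc 0 lam, 0 ≤ sig x := fun x hx => by
    have := sig_mono hx.1; rwa [sig_zero] at this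
  have h1 := J_gen lam ν 1 (by norm_num) hlam (fun x hx => by
    have := hs0 x hx; linarith)
  have h2 := J_gen lam ν (-1) (by norm_num) hlam (fun x hx => by
    have := sig_mono hx.2; linarith)
  have e3 : Jp ν lam = ∫ l' in (0:ℝ)..lam,
      sig l' * deriv (fun x => LG (ν + (1 + 1 * sig x) / 2)) l' := by
    simp only [Jp, LG, one_mul]
  have e4 : Jm ν lam = ∫ l' in (0:ℝ)..lam,
      sig l' * deriv (fun x => LG (ν + (1 + -1 * sig x) / 2)) l' := by
    simp only [Jm, LG, neg_mul, one_mul, sub_eq_add_neg]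
  have hσ := hs0 lam ⟨hlam.1.le, le_rfl⟩
  rw [e3, e4, h1, h2]
  clear h1 h2 e3 e4 hs0
  simp only [FG_eq, sfun]
  generalize sig lam = σ at *
  obtain ⟨a, ha⟩ : ∃ a, a = ν + 1/2 := ⟨_, rfl⟩
  obtain ⟨p, hp⟩ : ∃ p, p = a + σ/2 := ⟨_, rfl⟩
  obtain ⟨q, hq⟩ : ∃ q, q = a - σ/2 := ⟨_, rfl⟩
  have q0 : 0 < q := by linarith
  have p0 : 0 < p := by linarith
  have a0 : 0 < a := by linarith
  rw [show ν + (1 + 1 * σ) / 2 = p by rw [hp, ha]; ring,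
    show ν + (1 + -1 * σ) / 2 = q by rw [hq, ha]; ring, ← ha,
    show 1 + (ν - (1 - σ) / 2) = p by rw [hp, ha]; ring,
    show 1 + (ν + (1 - σ) / 2) = q + 1 by rw [hq, ha]; ring,
    show 1 + (ν - 1 / 2) = a by rw [ha]; ring,
    show 1 - (1 - σ) / 2 + ν = p by rw [hp, ha]; ring,
    show 1 + (1 - σ) / 2 + ν = q + 1 by rw [hq, ha]; ring,
    show 1 / 2 + ν = a by rw [ha]; ring,
    show (1 - σ) / 2 + ν = q by rw [hq, ha]; ring]
  have gp := Real.Gamma_pos_of_pos p0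
  have ga := Real.Gamma_pos_of_pos a0
  have gq := Real.Gamma_pos_of_pos (by linarith : 0 < q + 1)
  rw [Real.log_div (by positivity) (by positivity), Real.log_mul gp.ne' gq.ne', Real.log_pow]
  change _ = _ + _ + (1 - 2 * ν) * (LG p + LG (q + 1) - ((2 : ℕ) : ℝ) * LG a)
    - 2 * LG (q + 1) + _
  have r := raabe q0
  have r2 : MG (q + 1) = MG q + (q * Real.log q - q + 1/2 * Real.log (2 * Real.pi)) := by linarith
  rw [r2, LG_add_one q0]
  have hν' : ν = a - 1/2 := by linarith
  subst hq hp
  subst hν'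
  push_cast
  ring
end

section
/- Let σ ∈ (0,1), ν ∈ ℝ, B > 0, and let q, p : (0,∞) → ℝ be functions for which there exist constants C > 0 and t₀ ∈ (0,1) such that for all t ∈ (0,t₀): exp(−q(t)) = B·t^σ·(1+r₁(t)) and p(t) = σ + r₂(t) with |r₁(t)| ≤ C·t^{1−σ} and |r₂(t)| ≤ C·t^{1−σ}. Then the Hamiltonian H(t) := (t/2)·sinh²(q(t)) − p(t)²/(2t) + 4ν·sinh²(q(t)/2) satisfies H(t) = −σ²/(2t) + O(t^{−σ}) as t ↓ 0; that is, there exist C' > 0 and t₁ ∈ (0,1) such that |H(t) + σ²/(2t)| ≤ C'·t^{−σ} for all t ∈ (0,t₁). -/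
/- STATEMENT 7 (Proposition 3.3): small-t behavior of the Hamiltonian,
H(t) = −σ²/(2t) + O(t^{−σ}). -/

set_option maxHeartbeats 2000000

theorem stmt7 (σ ν B : ℝ) (hσ : σ ∈ Set.Ioo (0:ℝ) 1) (hB : 0 < B)
    (q p : ℝ → ℝ) (C t₀ : ℝ) (hC : 0 < C) (ht₀ : t₀ ∈ Set.Ioo (0:ℝ) 1)
    (hq : ∀ t ∈ Set.Ioo (0:ℝ) t₀, ∃ r₁ : ℝ,
      Real.exp (-(q t)) = B * t ^ σ * (1 + r₁) ∧ |r₁| ≤ C * t ^ (1 - σ))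
    (hp : ∀ t ∈ Set.Ioo (0:ℝ) t₀, ∃ r₂ : ℝ,
      p t = σ + r₂ ∧ |r₂| ≤ C * t ^ (1 - σ)) :
    ∃ C' t₁ : ℝ, 0 < C' ∧ t₁ ∈ Set.Ioo (0:ℝ) 1 ∧ ∀ t ∈ Set.Ioo (0:ℝ) t₁,
      |(t/2 * Real.sinh (q t) ^ 2 - (p t)^2 / (2 * t) + 4 * ν * Real.sinh (q t / 2) ^ 2)
          + σ^2 / (2 * t)|
        ≤ C' * t ^ (-σ) := by
  obtain ⟨hσ0, hσ1⟩ := hσ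
  obtain ⟨ht00, ht01⟩ := ht₀
  have htend : Filter.Tendsto (fun t : ℝ => C * t ^ (1 - σ)) (nhds 0) (nhds 0) := by
    have h : ContinuousAt (fun t : ℝ => C * t ^ (1 - σ)) 0 :=
      continuousAt_const.mul (Real.continuousAt_rpow_const _ _ (Or.inr (by linarith)))
    have h2 := h.tendsto
    simp only [Real.zero_rpow (by linarith : (1 - σ) ≠ 0), mul_zero] at h2
    exact h2
  have hev := htend.eventually (gt_mem_nhds (show (0:ℝ) < 1 / 2 by norm_num))
  obtain ⟨ε, hε, hball⟩ := Metric.eventually_nhds_iff.1 hev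
  set K : ℝ := 2 / B + 2 * B with hK
  have hKpos : 0 < K := by positivity
  refine ⟨K ^ 2 + (C + C ^ 2) + 2 * |ν| * K, min ε t₀, by positivity,
    ⟨lt_min hε ht00, (min_le_right _ _).trans_lt ht01⟩, ?_⟩
  rintro t ⟨ht, htm⟩
  have htε : t < ε := htm.trans_le (min_le_left _ _)
  have htt : t < t₀ := htm.trans_le (min_le_right _ _)
  have hsmall : C * t ^ (1 - σ) < 1 / 2 := hball (by simpa [abs_of_pos ht] using htε)
  obtain ⟨r₁, he, hr₁⟩ := hq t ⟨ht, htt⟩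
  obtain ⟨r₂, hpe, hr₂⟩ := hp t ⟨ht, htt⟩
  have hs : 0 < t ^ σ := Real.rpow_pos_of_pos ht _
  have hs1 : t ^ σ ≤ 1 := Real.rpow_le_one ht.le (by linarith) hσ0.le
  have hu : 0 < t ^ (-σ) := Real.rpow_pos_of_pos ht _
  have hsu : t ^ σ * t ^ (-σ) = 1 := by rw [← Real.rpow_add ht]; simp
  have htu : t ^ (1 - σ) = t * t ^ (-σ) := by
    rw [sub_eq_add_neg, Real.rpow_add ht, Real.rpow_one]
  have htu1 : t * t ^ (-σ) ≤ 1 := by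
    rw [← htu]; exact Real.rpow_le_one ht.le (by linarith) (by linarith)
  rw [htu] at hsmall hr₁ hr₂
  generalize t ^ σ = s at *
  generalize t ^ (-σ) = u at *
  have hu1 : 1 ≤ u := by nlinarith
  have hr := abs_le.1 hr₁
  have hEe : Real.exp (q t) * Real.exp (-(q t)) = 1 := by rw [← Real.exp_add]; simp
  have hE0 := Real.exp_pos (q t)
  have he0 := Real.exp_pos (-(q t))
  have hBs : 0 < B * s := by positivity
  have helow : B * s / 2 ≤ Real.exp (-(q t)) := by rw [he]; nlinarith
  have heup : Real.exp (-(q t)) ≤ K * u := by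
    have h1 : Real.exp (-(q t)) ≤ 2 * (B * s) := by rw [he]; nlinarith
    have h2 : B * s ≤ B := by nlinarith
    have h3 : 0 < 2 / B := by positivity
    nlinarith
  have hEup : Real.exp (q t) ≤ K * u := by
    have h1 : Real.exp (q t) * (B * s / 2) ≤ 1 := by
      rw [← hEe]; exact mul_le_mul_of_nonneg_left helow hE0.le
    have h2 : Real.exp (q t) ≤ 2 / B * u := by
      have h3 : Real.exp (q t) = Real.exp (q t) * (B * s / 2) * (2 / B * u) := by
        have : Real.exp (q t) * (B * s / 2) * (2 / B * u) = Real.exp (q t) * (s * u) := by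
          field_simp
        rw [this, hsu, mul_one]
      rw [h3]
      exact mul_le_of_le_one_left (by positivity) h1
    nlinarith [mul_pos hB hu]
  have hsq1 : Real.sinh (q t) ^ 2 =
      (Real.exp (q t) ^ 2 + Real.exp (-(q t)) ^ 2 - 2) / 4 := by
    rw [Real.sinh_eq]; linear_combination (-1 / 2) * hEe
  have hsq2 : 4 * Real.sinh (q t / 2) ^ 2 = Real.exp (q t) + Real.exp (-(q t)) - 2 := by
    have h1 : Real.exp (q t) = Real.exp (q t / 2) ^ 2 := by
      rw [← Real.exp_nat_mul]; congr 1; push_cast; ring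
    have h2 : Real.exp (-(q t)) = Real.exp (-(q t / 2)) ^ 2 := by
      rw [← Real.exp_nat_mul]; congr 1; push_cast; ring
    have h3 : Real.exp (q t / 2) * Real.exp (-(q t / 2)) = 1 := by
      rw [← Real.exp_add]; simp
    rw [Real.sinh_eq, h1, h2]; linear_combination (-2) * h3
  have hA : |t / 2 * Real.sinh (q t) ^ 2| ≤ K ^ 2 * u := by
    rw [abs_of_nonneg (by positivity)]
    have h1 : Real.exp (q t) ^ 2 ≤ (K * u) ^ 2 := pow_le_pow_left₀ hE0.le hEup 2
    have h2 : Real.exp (-(q t)) ^ 2 ≤ (K * u) ^ 2 := pow_le_pow_left₀ he0.le heup 2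
    have h3 : Real.sinh (q t) ^ 2 ≤ (K * u) ^ 2 := by rw [hsq1]; nlinarith
    calc t / 2 * Real.sinh (q t) ^ 2 ≤ t * (K * u) ^ 2 := by
          apply mul_le_mul (by linarith) h3 (by positivity) ht.le
      _ = (K ^ 2 * u) * (t * u) := by ring
      _ ≤ K ^ 2 * u := mul_le_of_le_one_right (by positivity) htu1
  have hD : |4 * ν * Real.sinh (q t / 2) ^ 2| ≤ 2 * |ν| * K * u := by
    have h0 : 4 * ν * Real.sinh (q t / 2) ^ 2 = ν * (4 * Real.sinh (q t / 2) ^ 2) := by ring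
    rw [h0, abs_mul, abs_of_nonneg (by positivity : 0 ≤ 4 * Real.sinh (q t / 2) ^ 2), hsq2]
    calc |ν| * (Real.exp (q t) + Real.exp (-(q t)) - 2) ≤ |ν| * (2 * K * u) :=
          mul_le_mul_of_nonneg_left (by linarith) (abs_nonneg _)
      _ = _ := by ring
  have hP : |σ ^ 2 / (2 * t) - (p t) ^ 2 / (2 * t)| ≤ (C + C ^ 2) * u := by
    have h0 : σ ^ 2 / (2 * t) - (p t) ^ 2 / (2 * t) = -(r₂ * (2 * σ + r₂)) / (2 * t) := by
      rw [hpe]; ring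
    rw [h0, abs_div, abs_neg, abs_mul, abs_of_pos (by positivity : 0 < 2 * t),
      div_le_iff₀ (by positivity)]
    have h1 : |2 * σ + r₂| ≤ 2 + C := by
      have h2 : C * (t * u) ≤ C := mul_le_of_le_one_right hC.le htu1
      have h3 := abs_le.1 (hr₂.trans h2)
      exact abs_le.2 ⟨by linarith, by linarith⟩
    calc |r₂| * |2 * σ + r₂| ≤ (C * (t * u)) * (2 + C) :=
          mul_le_mul hr₂ h1 (abs_nonneg _) (by positivity)
      _ ≤ (C + C ^ 2) * u * (2 * t) := by
          have : 0 ≤ C ^ 2 * (t * u) := by positivity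
          nlinarith
  have hsplit : t / 2 * Real.sinh (q t) ^ 2 - (p t) ^ 2 / (2 * t)
      + 4 * ν * Real.sinh (q t / 2) ^ 2 + σ ^ 2 / (2 * t)
      = t / 2 * Real.sinh (q t) ^ 2 + (σ ^ 2 / (2 * t) - (p t) ^ 2 / (2 * t))
        + 4 * ν * Real.sinh (q t / 2) ^ 2 := by ring
  rw [hsplit]
  refine (abs_add_three _ _ _).trans ?_
  linarith
end
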